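/- arXiv:1205.2682 — 2 statements merged into one kernel-verified Lean document; each statement's English description precedes it below -/
import Mathlib

section
/- There exists an absolute constant c > 0 with the following property: for all integers n ≥ 1 and d ≥ 1, for every polynomial Q : ℝⁿ → ℝ of total degree at most d, for every α > 0, and with γ denoting the standard Gaussian measure on ℝⁿ (the law of n independent standard normal random variables), one has (∫_{ℝⁿ} Q(x)² dγ(x))^{1/(2d)} · γ({x ∈ ℝⁿ : |Q(x)| ≤ α}) ≤ c · d · α^{1/d}. -/
open MeasureTheory ProbabilityTheory

namespace CW

open scoped Pointwise

lemma bm_compact (K L : Set ℝ) (hK : IsCompact K) (hL : IsCompact L) (hKn : K.Nonempty)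
    (hLn : L.Nonempty) (l : ℝ) (h0 : 0 < l) (h1 : l < 1) (C : Set ℝ)
    (hC : ∀ x ∈ K, ∀ y ∈ L, (1 - l) * x + l * y ∈ C) :
    ENNReal.ofReal (1 - l) * volume K + ENNReal.ofReal l * volume L ≤ volume C := by
  obtain ⟨a, haK, ha⟩ := hK.exists_isGreatest hKn
  obtain ⟨b, hbL, hb⟩ := hL.exists_isLeast hLn
  set S1 : Set ℝ := (fun x => (1 - l) * x + l * b) '' K with hS1
  set S2 : Set ℝ := (fun y => (1 - l) * a + l * y) '' L with hS2
  have hS1c : IsCompact S1 := hK.image (by fun_prop)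
  have hS2c : IsCompact S2 := hL.image (by fun_prop)
  have v1 : volume S1 = ENNReal.ofReal (1 - l) * volume K := by
    have : S1 = (fun z => z + l * b) '' ((1 - l) • K) := by
      rw [hS1, ← Set.image_smul, Set.image_image]; rfl
    rw [this, Set.image_add_right, measure_preimage_add_right, Measure.addHaar_smul]
    simp [abs_of_pos (show 0 < 1 - l by linarith)]
  have v2 : volume S2 = ENNReal.ofReal l * volume L := by
    have : S2 = (fun z => (1 - l) * a + z) '' (l • L) := by
      rw [hS2, ← Set.image_smul, Set.image_image]; rfl
    rw [this, Set.image_add_left, measure_preimage_add, Measure.addHaar_smul]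
    simp [abs_of_pos h0]
  have hsub : S1 ∪ S2 ⊆ C := by
    rintro z (⟨x, hx, rfl⟩ | ⟨y, hy, rfl⟩)
    · exact hC x hx b hbL
    · exact hC a haK y hy
  have hdis : AEDisjoint volume S1 S2 := by
    have : S1 ∩ S2 ⊆ {(1 - l) * a + l * b} := by
      rintro z ⟨⟨x, hx, rfl⟩, ⟨y, hy, hxy⟩⟩
      have h2 := ha hx
      have h3 := hb hy
      simp only [Set.mem_singleton_iff] at *
      nlinarith
    exact measure_mono_null this (by simp)
  rw [← v1, ← v2, ← measure_union₀ hS2c.measurableSet.nullMeasurableSet hdis]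
  exact measure_mono hsub

lemma bm1 (A B C : Set ℝ) (hA : MeasurableSet A) (hB : MeasurableSet B) (hAn : A.Nonempty)
    (hBn : B.Nonempty) (l : ℝ) (h0 : 0 < l) (h1 : l < 1)
    (hC : ∀ x ∈ A, ∀ y ∈ B, (1 - l) * x + l * y ∈ C) :
    ENNReal.ofReal (1 - l) * volume A + ENNReal.ofReal l * volume B ≤ volume C := by
  obtain ⟨a, ha⟩ := hAn
  obtain ⟨b, hb⟩ := hBn
  rw [hA.measure_eq_iSup_isCompact, hB.measure_eq_iSup_isCompact]
  simp only [ENNReal.mul_iSup]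
  rw [ENNReal.iSup_add]
  refine iSup_le fun K => ?_
  rw [ENNReal.add_iSup]
  refine iSup_le fun L => ?_
  by_cases hK : K ⊆ A
  swap
  · simp only [hK, iSup_false, bot_eq_zero', zero_add]
    refine iSup_le fun hL => iSup_le fun hLc => ?_
    by_cases hLn : L.Nonempty
    · have := bm_compact {a} L isCompact_singleton hLc (by simp) hLn l h0 h1 C
        (by rintro x rfl y hy; exact hC _ ha _ (hL hy))
      simpa using this
    · rw [Set.not_nonempty_iff_eq_empty.1 hLn]; simp
  by_cases hKc : IsCompact K
  swap
  · simp only [hKc, hK, iSup_false, bot_eq_zero', zero_add, iSup_true]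
    refine iSup_le fun hL => iSup_le fun hLc => ?_
    by_cases hLn : L.Nonempty
    · have := bm_compact {a} L isCompact_singleton hLc (by simp) hLn l h0 h1 C
        (by rintro x rfl y hy; exact hC _ ha _ (hL hy))
      simpa using this
    · rw [Set.not_nonempty_iff_eq_empty.1 hLn]; simp
  simp only [hK, hKc, iSup_true]
  -- enlarge both compact sets by one point
  have key : ∀ L' : Set ℝ, IsCompact L' → L' ⊆ B →
      ENNReal.ofReal (1 - l) * volume K + ENNReal.ofReal l * volume L' ≤ volume C := by
    intro L' hL'c hL'
    have := bm_compact (insert a K) (insert b L') (hKc.insert a) (hL'c.insert b) (by simp) (by simp)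
      l h0 h1 C (by
        intro x hx y hy
        apply hC
        · rcases hx with rfl | hx
          · exact ha
          · exact hK hx
        · rcases hy with rfl | hy
          · exact hb
          · exact hL' hy)
    refine le_trans ?_ this
    gcongr
    · exact Set.subset_insert _ _
    · exact Set.subset_insert _ _
  by_cases hL : L ⊆ B
  swap
  · simpa [hL] using key ∅ isCompact_empty (by simp)
  by_cases hLc : IsCompact L
  swap
  · simpa [hL, hLc] using key ∅ isCompact_empty (by simp)
  simpa [hL, hLc] using key L hLc hL

lemma pl1_norm (f g h : ℝ → ℝ) (hf0 : ∀ x, 0 ≤ f x) (hg0 : ∀ x, 0 ≤ g x) (hh0 : ∀ x, 0 ≤ h x)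
    (hfm : Measurable f) (hgm : Measurable g) (hhm : Measurable h)
    (hfi : Integrable f) (hgi : Integrable g) (hhi : Integrable h)
    (hf1 : ∀ x, f x ≤ 1) (hg1 : ∀ x, g x ≤ 1)
    (hfs : ∀ t < 1, ∃ x, t < f x) (hgs : ∀ t < 1, ∃ x, t < g x)
    (l : ℝ) (h0 : 0 < l) (h1 : l < 1)
    (H : ∀ x y, f x ^ (1 - l) * g y ^ l ≤ h ((1 - l) * x + l * y)) :
    (1 - l) * (∫ x, f x) + l * (∫ x, g x) ≤ ∫ x, h x := by
  have key : ENNReal.ofReal (1 - l) * (∫⁻ x, ENNReal.ofReal (f x))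
      + ENNReal.ofReal l * (∫⁻ x, ENNReal.ofReal (g x)) ≤ ∫⁻ x, ENNReal.ofReal (h x) := by
    rw [lintegral_eq_lintegral_meas_lt _ (.of_forall hf0) hfm.aemeasurable,
      lintegral_eq_lintegral_meas_lt _ (.of_forall hg0) hgm.aemeasurable,
      lintegral_eq_lintegral_meas_lt _ (.of_forall hh0) hhm.aemeasurable]
    rw [← lintegral_const_mul' _ _ (by simp), ← lintegral_const_mul' _ _ (by simp)]
    rw [← lintegral_add_left']
    · refine setLIntegral_mono' measurableSet_Ioi fun t ht => ?_
      have ht : 0 < t := ht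
      by_cases ht1 : t < 1
      · apply bm1 _ _ _ (measurableSet_lt measurable_const hfm) (measurableSet_lt measurable_const hgm)
          (hfs t ht1) (hgs t ht1) l h0 h1
        intro x hx y hy
        have hx : t < f x := hx
        have hy : t < g y := hy
        show t < h _
        refine lt_of_lt_of_le ?_ (H x y)
        calc t = t ^ (1 - l) * t ^ l := by
              rw [← Real.rpow_add ht]; simp
          _ < _ := by
              have a1 := Real.rpow_lt_rpow ht.le hx (show 0 < 1 - l by linarith)
              have a2 := Real.rpow_lt_rpow ht.le hy h0
              have a3 := Real.rpow_pos_of_pos ht l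
              have a4 := Real.rpow_pos_of_pos ht (1 - l)
              nlinarith
      · have e1 : {a | t < f a} = ∅ := by
          ext x; simp; linarith [hf1 x]
        have e2 : {a | t < g a} = ∅ := by
          ext x; simp; linarith [hg1 x]
        simp [e1, e2]
    · apply AEMeasurable.const_mul
      apply Measurable.aemeasurable
      apply Antitone.measurable
      intro s t hst
      exact measure_mono fun x hx => lt_of_le_of_lt hst hx
  rw [← ofReal_integral_eq_lintegral_ofReal hfi (.of_forall hf0),
    ← ofReal_integral_eq_lintegral_ofReal hgi (.of_forall hg0),
    ← ofReal_integral_eq_lintegral_ofReal hhi (.of_forall hh0),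
    ← ENNReal.ofReal_mul (by linarith), ← ENNReal.ofReal_mul h0.le,
    ← ENNReal.ofReal_add] at key
  · exact (ENNReal.ofReal_le_ofReal_iff (integral_nonneg hh0)).1 key
  · exact mul_nonneg (by linarith) (integral_nonneg hf0)
  · exact mul_nonneg (by linarith) (integral_nonneg hg0)

lemma pl1 (f g h : ℝ → ℝ) (hf0 : ∀ x, 0 ≤ f x) (hg0 : ∀ x, 0 ≤ g x) (hh0 : ∀ x, 0 ≤ h x)
    (hfm : Measurable f) (hgm : Measurable g) (hhm : Measurable h)
    (hfi : Integrable f) (hgi : Integrable g) (hhi : Integrable h)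
    (hfb : BddAbove (Set.range f)) (hgb : BddAbove (Set.range g))
    (l : ℝ) (h0 : 0 < l) (h1 : l < 1)
    (H : ∀ x y, f x ^ (1 - l) * g y ^ l ≤ h ((1 - l) * x + l * y)) :
    (∫ x, f x) ^ (1 - l) * (∫ x, g x) ^ l ≤ ∫ x, h x := by
  set a := ⨆ x, f x with ha
  set b := ⨆ x, g x with hb
  have hfa : ∀ x, f x ≤ a := fun x => le_ciSup hfb x
  have hgb' : ∀ x, g x ≤ b := fun x => le_ciSup hgb x
  have hI : 0 ≤ ∫ x, h x := integral_nonneg hh0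
  have ha0 : 0 ≤ a := (hf0 0).trans (hfa 0)
  have hb0 : 0 ≤ b := (hg0 0).trans (hgb' 0)
  rcases ha0.eq_or_lt with ha0 | ha0
  · have : f = fun _ => 0 := by
      ext x; exact le_antisymm (by rw [ha0]; exact hfa x) (hf0 x)
    rw [this]; simp [Real.zero_rpow (show 1 - l ≠ 0 by linarith), hI]
  rcases hb0.eq_or_lt with hb0 | hb0
  · have : g = fun _ => 0 := by
      ext x; exact le_antisymm (by rw [hb0]; exact hgb' x) (hg0 x)
    rw [this]; simp [Real.zero_rpow h0.ne', hI]
  set c := a ^ (1 - l) * b ^ l with hc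
  have hc0 : 0 < c := by positivity
  have := pl1_norm (fun x => f x / a) (fun x => g x / b) (fun x => h x / c)
    (fun x => div_nonneg (hf0 x) ha0.le) (fun x => div_nonneg (hg0 x) hb0.le)
    (fun x => div_nonneg (hh0 x) hc0.le) (hfm.div_const _) (hgm.div_const _) (hhm.div_const _)
    (hfi.div_const _) (hgi.div_const _) (hhi.div_const _)
    (fun x => (div_le_one ha0).2 (hfa x)) (fun x => (div_le_one hb0).2 (hgb' x))
    (fun t ht => by
      obtain ⟨x, hx⟩ := exists_lt_of_lt_ciSup (show t * a < ⨆ x, f x by rw [← ha]; nlinarith)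
      exact ⟨x, (lt_div_iff₀ ha0).2 hx⟩)
    (fun t ht => by
      obtain ⟨x, hx⟩ := exists_lt_of_lt_ciSup (show t * b < ⨆ x, g x by rw [← hb]; nlinarith)
      exact ⟨x, (lt_div_iff₀ hb0).2 hx⟩) l h0 h1
    (fun x y => by
      rw [Real.div_rpow (hf0 x) ha0.le, Real.div_rpow (hg0 y) hb0.le, div_mul_div_comm]
      exact div_le_div_of_nonneg_right (H x y) hc0.le)
  rw [integral_div, integral_div, integral_div] at this
  have h2 := Real.geom_mean_le_arith_mean2_weighted (show 0 ≤ 1 - l by linarith) h0.le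
    (div_nonneg (integral_nonneg hf0) ha0.le : 0 ≤ (∫ x, f x) / a)
    (div_nonneg (integral_nonneg hg0) hb0.le : 0 ≤ (∫ x, g x) / b) (by ring)
  have h3 := h2.trans this
  rw [Real.div_rpow (integral_nonneg hf0) ha0.le, Real.div_rpow (integral_nonneg hg0) hb0.le,
    div_mul_div_comm, div_le_div_iff_of_pos_right hc0] at h3
  exact h3

lemma gauss_pdf_lc (l : ℝ) (h0 : 0 < l) (h1 : l < 1) (x y : ℝ) :
    gaussianPDFReal 0 1 x ^ (1 - l) * gaussianPDFReal 0 1 y ^ l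
      ≤ gaussianPDFReal 0 1 ((1 - l) * x + l * y) := by
  simp only [gaussianPDFReal]
  set k := (√(2 * Real.pi * ((1 : NNReal) : ℝ)))⁻¹ with hk
  have hk0 : 0 < k := by rw [hk]; positivity
  rw [Real.mul_rpow hk0.le (Real.exp_pos _).le, Real.mul_rpow hk0.le (Real.exp_pos _).le,
    ← Real.exp_mul, ← Real.exp_mul, mul_mul_mul_comm, ← Real.rpow_add hk0, ← Real.exp_add]
  simp only [sub_add_cancel, Real.rpow_one]
  gcongr
  simp only [NNReal.coe_one]
  nlinarith [mul_nonneg (mul_nonneg h0.le (show 0 ≤ 1 - l by linarith)) (sq_nonneg (x - y))]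

lemma pl_gauss1 (f g h : ℝ → ℝ) (hf0 : ∀ x, 0 ≤ f x) (hg0 : ∀ x, 0 ≤ g x) (hh0 : ∀ x, 0 ≤ h x)
    (hfm : Measurable f) (hgm : Measurable g) (hhm : Measurable h)
    (hf1 : ∀ x, f x ≤ 1) (hg1 : ∀ x, g x ≤ 1) (hh1 : ∀ x, h x ≤ 1)
    (l : ℝ) (h0 : 0 < l) (h1 : l < 1)
    (H : ∀ x y, f x ^ (1 - l) * g y ^ l ≤ h ((1 - l) * x + l * y)) :
    (∫ x, f x ∂(gaussianReal 0 1)) ^ (1 - l) * (∫ x, g x ∂(gaussianReal 0 1)) ^ l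
      ≤ ∫ x, h x ∂(gaussianReal 0 1) := by
  simp only [integral_gaussianReal_eq_integral_smul (one_ne_zero : (1 : NNReal) ≠ 0), smul_eq_mul]
  set p := gaussianPDFReal 0 1 with hp
  have p0 : ∀ x, 0 ≤ p x := gaussianPDFReal_nonneg 0 1
  have pm : Measurable p := measurable_gaussianPDFReal 0 1
  have pint : ∀ u : ℝ → ℝ, Measurable u → (∀ x, 0 ≤ u x) → (∀ x, u x ≤ 1) →
      Integrable (fun x => p x * u x) := by
    intro u hu hu0 hu1
    refine (integrable_gaussianPDFReal 0 1).mono' (pm.mul hu).aestronglyMeasurable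
      (.of_forall fun x => ?_)
    rw [Real.norm_of_nonneg (mul_nonneg (p0 x) (hu0 x))]
    exact mul_le_of_le_one_right (p0 x) (hu1 x)
  have pb : ∀ x, p x ≤ (√(2 * Real.pi))⁻¹ := by
    intro x
    simp only [hp, gaussianPDFReal]
    simp only [NNReal.coe_one, mul_one]
    apply mul_le_of_le_one_right (by positivity)
    rw [Real.exp_le_one_iff]
    have := sq_nonneg (x - 0)
    linarith
  have bdd : ∀ u : ℝ → ℝ, (∀ x, 0 ≤ u x) → (∀ x, u x ≤ 1) →
      BddAbove (Set.range fun x => p x * u x) := by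
    intro u hu0 hu1
    refine ⟨(√(2 * Real.pi))⁻¹, ?_⟩
    rintro _ ⟨x, rfl⟩
    exact (mul_le_of_le_one_right (p0 x) (hu1 x)).trans (pb x)
  apply pl1 _ _ _ (fun x => mul_nonneg (p0 x) (hf0 x)) (fun x => mul_nonneg (p0 x) (hg0 x))
    (fun x => mul_nonneg (p0 x) (hh0 x)) (pm.mul hfm) (pm.mul hgm) (pm.mul hhm)
    (pint f hfm hf0 hf1) (pint g hgm hg0 hg1) (pint h hhm hh0 hh1) (bdd f hf0 hf1) (bdd g hg0 hg1)
    l h0 h1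
  intro x y
  rw [Real.mul_rpow (p0 x) (hf0 x), Real.mul_rpow (p0 y) (hg0 y), mul_mul_mul_comm]
  exact mul_le_mul (gauss_pdf_lc l h0 h1 x y) (H x y)
    (mul_nonneg (Real.rpow_nonneg (hf0 x) _) (Real.rpow_nonneg (hg0 y) _)) (p0 _)

end CW

namespace CW

/-- the standard Gaussian measure -/
noncomputable abbrev gam (n : ℕ) : Measure (Fin n → ℝ) := Measure.pi fun _ : Fin n => gaussianReal 0 1

lemma integral_gam_succ (n : ℕ) (f : (Fin (n + 1) → ℝ) → ℝ) (hf : Measurable f)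
    (hf0 : ∀ x, 0 ≤ f x) (hf1 : ∀ x, f x ≤ 1) :
    ∫ x, f x ∂(gam (n + 1)) = ∫ t, ∫ y, f (Fin.cons t y) ∂(gam n) ∂(gaussianReal 0 1) := by
  have hmp := (measurePreserving_piFinSuccAbove (fun _ : Fin (n + 1) => gaussianReal 0 1) 0).symm
  rw [← hmp.integral_comp']
  rw [integral_prod]
  · refine integral_congr_ae (.of_forall fun t => ?_)
    refine integral_congr_ae (.of_forall fun y => ?_)
    simp [MeasurableEquiv.piFinSuccAbove, Fin.insertNthEquiv]
  · refine (integrable_const (1 : ℝ)).mono' ?_ (.of_forall fun x => ?_)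
    · exact (hf.comp (MeasurableEquiv.measurable _)).aestronglyMeasurable
    · rw [Real.norm_of_nonneg (hf0 _)]; exact hf1 _

lemma pl_gam (n : ℕ) : ∀ (f g h : (Fin n → ℝ) → ℝ) (_ : ∀ x, 0 ≤ f x) (_ : ∀ x, 0 ≤ g x)
    (_ : ∀ x, 0 ≤ h x)
    (_ : Measurable f) (_ : Measurable g) (_ : Measurable h)
    (_ : ∀ x, f x ≤ 1) (_ : ∀ x, g x ≤ 1) (_ : ∀ x, h x ≤ 1)
    (l : ℝ) (_ : 0 < l) (_ : l < 1)
    (_ : ∀ x y, f x ^ (1 - l) * g y ^ l ≤ h ((1 - l) • x + l • y)),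
    (∫ x, f x ∂(gam n)) ^ (1 - l) * (∫ x, g x ∂(gam n)) ^ l ≤ ∫ x, h x ∂(gam n) := by
  induction n with
  | zero =>
    intro f g h hf0 hg0 hh0 hfm hgm hhm hf1 hg1 hh1 l h0 h1 H
    have : gam 0 = Measure.dirac 0 := by
      rw [gam, Measure.pi_of_empty]
      congr 1
      exact Subsingleton.elim _ _
    rw [this]
    simp only [integral_dirac]
    have := H 0 0
    simpa using this
  | succ n ih =>
    intro f g h hf0 hg0 hh0 hfm hgm hhm hf1 hg1 hh1 l h0 h1 H
    rw [integral_gam_succ n f hfm hf0 hf1, integral_gam_succ n g hgm hg0 hg1,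
      integral_gam_succ n h hhm hh0 hh1]
    have mc : Measurable (fun p : ℝ × (Fin n → ℝ) => (Fin.cons p.1 p.2 : Fin (n + 1) → ℝ)) := by
      rw [measurable_pi_iff]
      intro i
      refine Fin.cases ?_ (fun j => ?_) i
      · simpa using measurable_fst
      · simp only [Fin.cons_succ]
        exact (measurable_pi_apply j).comp measurable_snd
    have mF : ∀ u : (Fin (n + 1) → ℝ) → ℝ, Measurable u →
        Measurable (fun t : ℝ => ∫ y, u (Fin.cons t y) ∂(gam n)) := by
      intro u hu
      have : StronglyMeasurable (Function.uncurry fun (t : ℝ) (y : Fin n → ℝ) => u (Fin.cons t y)) :=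
        (hu.comp mc).stronglyMeasurable
      exact (this.integral_prod_right (ν := gam n)).measurable
    have mu : ∀ u : (Fin (n + 1) → ℝ) → ℝ, Measurable u → ∀ t : ℝ,
        Measurable (fun y : Fin n → ℝ => u (Fin.cons t y)) := by
      intro u hu t
      exact (hu.comp mc).comp measurable_prodMk_left
    have le1 : ∀ u : (Fin (n + 1) → ℝ) → ℝ, (∀ x, 0 ≤ u x) → (∀ x, u x ≤ 1) → ∀ t : ℝ,
        ∫ y, u (Fin.cons t y) ∂(gam n) ≤ 1 := by
      intro u hu0 hu t
      have := integral_mono_of_nonneg (μ := gam n) (f := fun y => u (Fin.cons t y)) (g := fun _ => 1)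
        (.of_forall fun y => hu0 _) (integrable_const _) (.of_forall fun y => hu _)
      simpa using this
    apply pl_gauss1 _ _ _ (fun t => integral_nonneg fun y => hf0 _)
      (fun t => integral_nonneg fun y => hg0 _) (fun t => integral_nonneg fun y => hh0 _)
      (mF f hfm) (mF g hgm) (mF h hhm) (le1 f hf0 hf1) (le1 g hg0 hg1) (le1 h hh0 hh1) l h0 h1
    intro s t
    apply ih _ _ _ (fun y => hf0 _) (fun y => hg0 _) (fun y => hh0 _) (mu f hfm s) (mu g hgm t)
      (mu h hhm _) (fun y => hf1 _) (fun y => hg1 _) (fun y => hh1 _) l h0 h1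
    intro x y
    refine (H _ _).trans_eq ?_
    congr 1
    ext i
    refine Fin.cases ?_ (fun j => ?_) i <;> simp

/-- log-concavity of the Gaussian measure on sets -/
lemma gam_lc (n : ℕ) (S T U : Set (Fin n → ℝ)) (hS : MeasurableSet S) (hT : MeasurableSet T)
    (hU : MeasurableSet U) (l : ℝ) (h0 : 0 < l) (h1 : l < 1)
    (H : ∀ x ∈ S, ∀ y ∈ T, (1 - l) • x + l • y ∈ U) :
    (gam n).real S ^ (1 - l) * (gam n).real T ^ l ≤ (gam n).real U := by
  have i0 : ∀ (V : Set (Fin n → ℝ)) x, 0 ≤ V.indicator (fun _ => (1 : ℝ)) x :=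
    fun V x => Set.indicator_nonneg (fun _ _ => zero_le_one) x
  have i1 : ∀ (V : Set (Fin n → ℝ)) x, V.indicator (fun _ => (1 : ℝ)) x ≤ 1 :=
    fun V x => Set.indicator_le_self' (fun _ _ => zero_le_one) x
  have im : ∀ (V : Set (Fin n → ℝ)), MeasurableSet V → Measurable (V.indicator (fun _ => (1 : ℝ))) :=
    fun V hV => measurable_const.indicator hV
  have := pl_gam n _ _ _ (i0 S) (i0 T) (i0 U) (im S hS) (im T hT) (im U hU) (i1 S) (i1 T) (i1 U)
    l h0 h1 (by
      intro x y
      by_cases hx : x ∈ S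
      · by_cases hy : y ∈ T
        · simp [hx, hy, H x hx y hy]
        · simp only [hy, not_false_eq_true, Set.indicator_of_notMem, Real.zero_rpow h0.ne', mul_zero]
          exact i0 _ _
      · simp only [hx, not_false_eq_true, Set.indicator_of_notMem,
          Real.zero_rpow (show 1 - l ≠ 0 by linarith), zero_mul]
        exact i0 _ _)
  simpa [integral_indicator_const _ hS, integral_indicator_const _ hT,
    integral_indicator_const _ hU] using this

lemma gam_graph (m : ℕ) (i : Fin (m + 1)) (F : (Fin m → ℝ) → ℝ) (hF : Measurable F) :
    gam (m + 1) {x | x i = F (fun k => x (i.succAbove k))} = 0 := by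
  have hmp := (measurePreserving_piFinSuccAbove (fun _ : Fin (m + 1) => gaussianReal 0 1) i).symm
  have hm : MeasurableSet {x : Fin (m + 1) → ℝ | x i = F (fun k => x (i.succAbove k))} :=
    measurableSet_eq_fun (by fun_prop) (hF.comp (by fun_prop))
  have : NullSingletonClass (gaussianReal 0 1) := nullSingletonClass_gaussianReal one_ne_zero
  rw [← hmp.measure_preimage hm.nullMeasurableSet]
  rw [Measure.prod_apply_symm ((MeasurableEquiv.measurable _) hm)]
  rw [lintegral_eq_zero_iff (measurable_measure_prodMk_right ((MeasurableEquiv.measurable _) hm))]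
  refine .of_forall fun y => ?_
  refine measure_mono_null (t := {F y}) ?_ (measure_singleton _)
  intro t ht
  simpa [MeasurableEquiv.piFinSuccAbove, Fin.insertNthEquiv] using ht

/-- hyperplanes with normal in a coordinate plane are null -/
lemma gam_hyper' (n : ℕ) (i j : Fin n) (hij : i ≠ j) (a b c : ℝ) (ha : a ≠ 0) :
    gam n {x | a * x i + b * x j = c} = 0 := by
  obtain ⟨m, rfl⟩ : ∃ m, n = m + 1 := ⟨n - 1, by have := i.pos; omega⟩
  obtain ⟨k, rfl⟩ := Fin.exists_succAbove_eq hij.symm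
  refine measure_mono_null ?_ (gam_graph m i (fun y => (c - b * y k) / a) (by fun_prop))
  intro x hx
  have hx : a * x i + b * x (i.succAbove k) = c := hx
  show x i = _
  field_simp
  linarith

lemma gam_hyper (n : ℕ) (i j : Fin n) (hij : i ≠ j) (a b c : ℝ) (ha : a ≠ 0 ∨ b ≠ 0) :
    gam n {x | a * x i + b * x j = c} = 0 := by
  rcases ha with ha | hb
  · exact gam_hyper' n i j hij a b c ha
  · have := gam_hyper' n j i hij.symm b a c hb
    simpa only [add_comm] using this

lemma gam_coord (n : ℕ) (i : Fin n) (c : ℝ) : gam n {x | x i = c} = 0 := by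
  obtain ⟨m, rfl⟩ : ∃ m, n = m + 1 := ⟨n - 1, by have := i.pos; omega⟩
  exact gam_graph m i (fun y => c) (by fun_prop)

end CW

namespace CW

/-- the sets produced by bisection -/
structure Good (n : ℕ) (g : (Fin n → ℝ) → ℝ) (A : Set (Fin n → ℝ)) (k : ℝ) (K : Set (Fin n → ℝ)) :
    Prop where
  cpt : IsCompact K
  cvx : Convex ℝ K
  pos : 0 < (gam n).real K
  bal : ∫ x in K, g x ∂(gam n) = 0
  big : k * (gam n).real K ≤ (gam n).real (A ∩ K)

/-- closed half space -/
def HS {n : ℕ} (i j : Fin n) (p q a b : ℝ) : Set (Fin n → ℝ) :=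
  {x | 0 ≤ a * (x i - p) + b * (x j - q)}

lemma HS_closed {n : ℕ} (i j : Fin n) (p q a b : ℝ) : IsClosed (HS i j p q a b) :=
  isClosed_le continuous_const (by fun_prop)

lemma HS_convex {n : ℕ} (i j : Fin n) (p q a b : ℝ) : Convex ℝ (HS i j p q a b) := by
  intro x hx y hy s t hs ht hst
  simp only [HS, Set.mem_ofPred_eq, Pi.add_apply, Pi.smul_apply, smul_eq_mul] at *
  have : a * (s * x i + t * y i - p) + b * (s * x j + t * y j - q)
      = s * (a * (x i - p) + b * (x j - q)) + t * (a * (y i - p) + b * (y j - q)) := by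
    have : t = 1 - s := by linarith
    subst this; ring
  rw [this]; positivity

lemma HS_null {n : ℕ} (i j : Fin n) (hij : i ≠ j) (p q a b : ℝ) (hab : a ≠ 0 ∨ b ≠ 0) :
    gam n {x | a * (x i - p) + b * (x j - q) = 0} = 0 := by
  rw [← gam_hyper n i j hij a b (a * p + b * q) hab]
  congr 1; ext x; simp only [Set.mem_ofPred_eq]; constructor <;> intro h <;> linarith

lemma HS_ae {n : ℕ} (i j : Fin n) (hij : i ≠ j) (p q a b : ℝ) (hab : a ≠ 0 ∨ b ≠ 0)
    (K : Set (Fin n → ℝ)) :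
    (K ∩ HS i j p q (-a) (-b) : Set (Fin n → ℝ)) =ᵐ[gam n] K \ HS i j p q a b := by
  have h : ∀ᵐ x ∂(gam n), ¬ (a * (x i - p) + b * (x j - q) = 0) := by
    rw [ae_iff]; simpa using HS_null i j hij p q a b hab
  filter_upwards [h] with x hx
  refine propext ?_
  show (x ∈ K ∧ 0 ≤ -a * (x i - p) + -b * (x j - q)) ↔ (x ∈ K ∧ ¬ (0 ≤ a * (x i - p) + b * (x j - q)))
  refine and_congr_right fun _ => ?_
  rw [not_le]
  constructor
  · intro h; refine lt_of_le_of_ne (by linarith) hx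
  · intro h; linarith

lemma cut {n : ℕ} {g : (Fin n → ℝ) → ℝ} (hg : Continuous g) {A : Set (Fin n → ℝ)}
    (hA : MeasurableSet A) {k : ℝ} {K : Set (Fin n → ℝ)} (hK : Good n g A k K)
    (i j : Fin n) (hij : i ≠ j) (p q : ℝ) :
    ∃ K', K' ⊆ K ∧ Good n g A k K' ∧ ∃ a b : ℝ, (a ≠ 0 ∨ b ≠ 0) ∧
      ∀ x ∈ K', 0 ≤ a * (x i - p) + b * (x j - q) := by
  have hKm : MeasurableSet K := hK.cpt.measurableSet
  have hgi : IntegrableOn g K (gam n) := hg.continuousOn.integrableOn_compact hK.cpt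
  have hne : ∀ θ : ℝ, Real.cos θ ≠ 0 ∨ Real.sin θ ≠ 0 := by
    intro θ
    by_contra! h
    have := Real.cos_sq_add_sin_sq θ
    rw [h.1, h.2] at this
    norm_num at this
  set G : ℝ → ℝ := fun θ => ∫ x in K, (HS i j p q (Real.cos θ) (Real.sin θ)).indicator g x ∂(gam n)
    with hG
  have hGc : Continuous G := by
    rw [continuous_iff_continuousAt]
    intro θ
    refine continuousAt_of_dominated (bound := fun x => |g x|) ?_ ?_ ?_ ?_
    · exact .of_forall fun t => (hg.measurable.indicator (HS_closed _ _ _ _ _ _).measurableSet).aestronglyMeasurable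
    · refine .of_forall fun t => .of_forall fun x => ?_
      exact norm_indicator_le_norm_self _ _
    · exact hgi.norm
    · have h : ∀ᵐ x ∂(gam n), ¬ (Real.cos θ * (x i - p) + Real.sin θ * (x j - q) = 0) := by
        rw [ae_iff]; simpa using HS_null i j hij p q _ _ (hne θ)
      filter_upwards [ae_restrict_of_ae h] with x hx
      have hc : Continuous fun t : ℝ => Real.cos t * (x i - p) + Real.sin t * (x j - q) := by fun_prop
      rcases lt_or_gt_of_ne hx with hx | hx
      · have := hc.continuousAt.eventually_lt continuousAt_const hx
        refine (continuousAt_const (y := (0 : ℝ))).congr ?_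
        filter_upwards [this] with t ht
        rw [Set.indicator_of_notMem]
        show ¬ (0 ≤ Real.cos t * (x i - p) + Real.sin t * (x j - q))
        exact not_le.2 ht
      · have := continuousAt_const.eventually_lt hc.continuousAt hx
        refine (continuousAt_const (y := g x)).congr ?_
        filter_upwards [this] with t ht
        rw [Set.indicator_of_mem]
        show 0 ≤ Real.cos t * (x i - p) + Real.sin t * (x j - q)
        exact ht.le
  have hGe : ∀ θ, G θ = ∫ x in K ∩ HS i j p q (Real.cos θ) (Real.sin θ), g x ∂(gam n) := by
    intro θ
    rw [hG]
    exact setIntegral_indicator (HS_closed _ _ _ _ _ _).measurableSet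
  have hcompl : ∀ a b : ℝ, (a ≠ 0 ∨ b ≠ 0) → (∫ x in K ∩ HS i j p q a b, g x ∂(gam n)) +
      ∫ x in K ∩ HS i j p q (-a) (-b), g x ∂(gam n) = 0 := by
    intro a b hab
    rw [setIntegral_congr_set (HS_ae i j hij p q a b hab K), ← hK.bal]
    exact integral_inter_add_sdiff (HS_closed _ _ _ _ _ _).measurableSet hgi
  have hGpi : G Real.pi = - G 0 := by
    rw [hGe, hGe]
    have := hcompl 1 0 (by simp)
    simp only [Real.cos_pi, Real.sin_pi, Real.cos_zero, Real.sin_zero]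
    rw [neg_zero] at this
    linarith
  obtain ⟨θ, hθ⟩ : ∃ θ, G θ = 0 := by
    rcases le_total (G 0) 0 with h | h
    · exact mem_range_of_exists_le_of_exists_ge hGc ⟨0, h⟩ ⟨Real.pi, by linarith⟩
    · exact mem_range_of_exists_le_of_exists_ge hGc ⟨Real.pi, by linarith⟩ ⟨0, h⟩
  set a := Real.cos θ with ha
  set b := Real.sin θ with hb
  have hab := hne θ
  rw [← ha, ← hb] at hab
  rw [hGe] at hθ
  have hc := hcompl a b hab
  set K1 := K ∩ HS i j p q a b with hK1
  set K2 := K ∩ HS i j p q (-a) (-b) with hK2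
  have m1 : (gam n).real K1 + (gam n).real K2 = (gam n).real K := by
    rw [measureReal_congr (HS_ae i j hij p q a b hab K)]
    exact measureReal_inter_add_sdiff (HS_closed _ _ _ _ _ _).measurableSet
  have m2 : (gam n).real (A ∩ K1) + (gam n).real (A ∩ K2) = (gam n).real (A ∩ K) := by
    have e1 : A ∩ K1 = (A ∩ K) ∩ HS i j p q a b := by rw [hK1, Set.inter_assoc]
    have e2 : A ∩ K2 = (A ∩ K) ∩ HS i j p q (-a) (-b) := by rw [hK2, Set.inter_assoc]
    rw [e1, e2, measureReal_congr (HS_ae i j hij p q a b hab (A ∩ K))]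
    exact measureReal_inter_add_sdiff (HS_closed _ _ _ _ _ _).measurableSet
  have n1 : 0 ≤ (gam n).real K1 := measureReal_nonneg
  have n2 : 0 ≤ (gam n).real K2 := measureReal_nonneg
  have l1 : (gam n).real (A ∩ K1) ≤ (gam n).real K1 := measureReal_mono Set.inter_subset_right
  have l2 : (gam n).real (A ∩ K2) ≤ (gam n).real K2 := measureReal_mono Set.inter_subset_right
  have hpos := hK.pos
  have hbig := hK.big
  have G1 : 0 < (gam n).real K1 → k * (gam n).real K1 ≤ (gam n).real (A ∩ K1) → Good n g A k K1 :=
    fun h1 h2 => ⟨hK.cpt.inter_right (HS_closed _ _ _ _ _ _), hK.cvx.inter (HS_convex _ _ _ _ _ _),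
      h1, hθ, h2⟩
  have G2 : 0 < (gam n).real K2 → k * (gam n).real K2 ≤ (gam n).real (A ∩ K2) → Good n g A k K2 :=
    fun h1 h2 => ⟨hK.cpt.inter_right (HS_closed _ _ _ _ _ _), hK.cvx.inter (HS_convex _ _ _ _ _ _),
      h1, by linarith, h2⟩
  have F1 : Good n g A k K1 → ∃ K', K' ⊆ K ∧ Good n g A k K' ∧ ∃ a b : ℝ, (a ≠ 0 ∨ b ≠ 0) ∧
      ∀ x ∈ K', 0 ≤ a * (x i - p) + b * (x j - q) := fun h =>
    ⟨K1, Set.inter_subset_left, h, a, b, hab, fun x hx => hx.2⟩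
  have F2 : Good n g A k K2 → ∃ K', K' ⊆ K ∧ Good n g A k K' ∧ ∃ a b : ℝ, (a ≠ 0 ∨ b ≠ 0) ∧
      ∀ x ∈ K', 0 ≤ a * (x i - p) + b * (x j - q) := fun h =>
    ⟨K2, Set.inter_subset_left, h, -a, -b, by simpa using hab, fun x hx => hx.2⟩
  rcases n1.eq_or_lt with z1 | z1
  · apply F2; apply G2
    · linarith
    · rw [← z1] at l1 m1
      have : (gam n).real K2 = (gam n).real K := by linarith
      rw [this]
      linarith
  rcases n2.eq_or_lt with z2 | z2
  · apply F1; apply G1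
    · linarith
    · rw [← z2] at l2 m1
      have : (gam n).real K1 = (gam n).real K := by linarith
      rw [this]
      linarith
  by_cases hh : k * (gam n).real K1 ≤ (gam n).real (A ∩ K1)
  · exact F1 (G1 z1 hh)
  · push Not at hh
    refine F2 (G2 z2 ?_)
    rw [← m1, ← m2] at hbig
    linarith

lemma cuts_aux {s t cv cw : ℝ} (h1 : 0 < s) (h2 : 0 < t) (h3 : s + t < 1)
    (Hx : 0 ≤ - (s * cv + t * cw)) (Hy : 0 ≤ cv - (s * cv + t * cw))
    (Hz : 0 ≤ cw - (s * cv + t * cw)) : cv = 0 ∧ cw = 0 := by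
  obtain ⟨E, hE⟩ : ∃ E, E = s * cv + t * cw := ⟨_, rfl⟩
  rw [← hE] at Hx Hy Hz
  have a1 := mul_nonneg h1.le Hy
  have a2 := mul_nonneg h2.le Hz
  have a3 : 0 ≤ (1 - s - t) * E := by linarith
  have a4 : 0 ≤ E := nonneg_of_mul_nonneg_right a3 (by linarith)
  have a5 : E = 0 := by linarith
  rw [a5] at Hy Hz hE
  have b1 := mul_nonneg h1.le (show 0 ≤ cv by linarith)
  have b2 := mul_nonneg h2.le (show 0 ≤ cw by linarith)
  constructor
  · exact (mul_eq_zero.1 (show s * cv = 0 by linarith)).resolve_left h1.ne'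
  · exact (mul_eq_zero.1 (show t * cw = 0 by linarith)).resolve_left (ne_of_gt h2)

/-- a convex set cut by half planes through all rational points is contained in a line -/
lemma line_of_cuts {n : ℕ} (S : Set (Fin n → ℝ)) (hS : Convex ℝ S)
    (h : ∀ i j : Fin n, i ≠ j → ∀ p q : ℚ, ∃ a b : ℝ, (a ≠ 0 ∨ b ≠ 0) ∧
      ∀ x ∈ S, 0 ≤ a * (x i - p) + b * (x j - q))
    (x y z : Fin n → ℝ) (hx : x ∈ S) (hy : y ∈ S) (hz : z ∈ S) (i j : Fin n) :
    (y i - x i) * (z j - x j) = (y j - x j) * (z i - x i) := by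
  by_cases hij : i = j
  · subst hij; ring
  by_contra hD
  set v1 := y i - x i with hv1
  set v2 := y j - x j with hv2
  set w1 := z i - x i with hw1
  set w2 := z j - x j with hw2
  set D := v1 * w2 - v2 * w1 with hDd
  have hD0 : D ≠ 0 := sub_ne_zero.2 hD
  -- Cramer coordinates
  set sf : ℝ × ℝ → ℝ := fun P => ((P.1 - x i) * w2 - (P.2 - x j) * w1) / D with hsf
  set tf : ℝ × ℝ → ℝ := fun P => (v1 * (P.2 - x j) - v2 * (P.1 - x i)) / D with htf
  have hsc : Continuous sf := by rw [hsf]; fun_prop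
  have htc : Continuous tf := by rw [htf]; fun_prop
  set O : Set (ℝ × ℝ) := {P | 0 < sf P ∧ 0 < tf P ∧ sf P + tf P < 1} with hO
  have hOo : IsOpen O := by
    have : O = {P | 0 < sf P} ∩ ({P | 0 < tf P} ∩ {P | sf P + tf P < 1}) := rfl
    rw [this]
    exact (isOpen_lt continuous_const hsc).inter ((isOpen_lt continuous_const htc).inter
      (isOpen_lt (hsc.add htc) continuous_const))
  have hOn : O.Nonempty := by
    refine ⟨(x i + v1 / 4 + w1 / 4, x j + v2 / 4 + w2 / 4), ?_⟩
    have e1 : sf (x i + v1 / 4 + w1 / 4, x j + v2 / 4 + w2 / 4) = 1 / 4 := by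
      simp only [hsf]; rw [div_eq_iff hD0, hDd]; ring
    have e2 : tf (x i + v1 / 4 + w1 / 4, x j + v2 / 4 + w2 / 4) = 1 / 4 := by
      simp only [htf]; rw [div_eq_iff hD0, hDd]; ring
    simp only [hO, Set.mem_ofPred_eq, e1, e2]
    norm_num
  have hdense : DenseRange (Prod.map ((↑) : ℚ → ℝ) ((↑) : ℚ → ℝ)) :=
    Rat.denseRange_cast.prodMap Rat.denseRange_cast
  obtain ⟨⟨p, q⟩, hpq⟩ := hdense.exists_mem_open hOo hOn
  obtain ⟨a, b, hab, H⟩ := h i j hij p q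
  simp only [Prod.map_apply] at hpq
  set P : ℝ × ℝ := ((p : ℝ), (q : ℝ)) with hP
  obtain ⟨h1, h2, h3⟩ := hpq
  set s := sf P with hs
  set t := tf P with ht
  have ep : (p : ℝ) = x i + s * v1 + t * w1 := by
    rw [hs, ht]; simp only [hsf, htf, hP]; field_simp; rw [hDd]; ring
  have eq : (q : ℝ) = x j + s * v2 + t * w2 := by
    rw [hs, ht]; simp only [hsf, htf, hP]; field_simp; rw [hDd]; ring
  have Hx := H x hx
  have Hy := H y hy
  have Hz := H z hz
  have ey1 : y i = x i + v1 := by rw [hv1]; ring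
  have ey2 : y j = x j + v2 := by rw [hv2]; ring
  have ez1 : z i = x i + w1 := by rw [hw1]; ring
  have ez2 : z j = x j + w2 := by rw [hw2]; ring
  rw [ep, eq] at Hx Hy Hz
  rw [ey1, ey2] at Hy
  rw [ez1, ez2] at Hz
  set cv := a * v1 + b * v2 with hcv
  set cw := a * w1 + b * w2 with hcw
  have Hx' : 0 ≤ - (s * cv + t * cw) := by rw [hcv, hcw]; linarith
  have Hy' : 0 ≤ cv - (s * cv + t * cw) := by rw [hcv, hcw]; linarith
  have Hz' : 0 ≤ cw - (s * cv + t * cw) := by rw [hcv, hcw]; linarith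
  obtain ⟨k1, k2⟩ := cuts_aux h1 h2 h3 Hx' Hy' Hz'
  have ea : a * D = 0 := by
    have : a * D = cv * w2 - cw * v2 := by rw [hcv, hcw, hDd]; ring
    rw [this, k1, k2]; ring
  have eb : b * D = 0 := by
    have : b * D = cw * v1 - cv * w1 := by rw [hcv, hcw, hDd]; ring
    rw [this, k1, k2]; ring
  rcases hab with hab | hab
  · exact mul_ne_zero hab hD0 ea
  · exact mul_ne_zero hab hD0 eb

lemma localize {n : ℕ} (hn : 1 ≤ n) {g : (Fin n → ℝ) → ℝ} (hg : Continuous g)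
    {A : Set (Fin n → ℝ)}
    (hA : MeasurableSet A) {k : ℝ} {K₀ : Set (Fin n → ℝ)} (hK₀ : Good n g A k K₀)
    (Q : (Fin n → ℝ) → ℝ) (hQ : Continuous Q) (e : ℝ) (he : 0 < e) :
    ∃ K, Good n g A k K ∧ ∃ (i : Fin n) (p v : Fin n → ℝ), ∀ x ∈ K, |Q x - Q (p + x i • v)| < e := by
  have step : ∀ (I : Fin n × Fin n × ℚ × ℚ) (K : {K // Good n g A k K}),
      ∃ K' : {K // Good n g A k K}, K'.1 ⊆ K.1 ∧ (I.1 ≠ I.2.1 → ∃ a b : ℝ, (a ≠ 0 ∨ b ≠ 0) ∧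
      ∀ x ∈ K'.1, 0 ≤ a * (x I.1 - I.2.2.1) + b * (x I.2.1 - I.2.2.2)) := by
    rintro ⟨i, j, p, q⟩ ⟨K, hK⟩
    by_cases hij : i = j
    · exact ⟨⟨K, hK⟩, subset_rfl, fun h => absurd hij h⟩
    · obtain ⟨K', h1, h2, h3⟩ := cut hg hA hK i j hij p q
      exact ⟨⟨K', h2⟩, h1, fun _ => h3⟩
  choose S hS1 hS2 using step
  haveI : Nonempty (Fin n) := ⟨⟨0, hn⟩⟩
  obtain ⟨en, hen⟩ := exists_surjective_nat (Fin n × Fin n × ℚ × ℚ)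
  let W : ℕ → {K // Good n g A k K} := fun m => Nat.rec ⟨K₀, hK₀⟩ (fun m K => S (en m) K) m
  have hWs : ∀ m, W (m + 1) = S (en m) (W m) := fun m => rfl
  have hWa : Antitone fun m => (W m).1 := by
    apply antitone_nat_of_succ_le
    intro m
    rw [hWs]; exact hS1 _ _
  set V : Set (Fin n → ℝ) := ⋂ m, (W m).1 with hV
  have hVc : Convex ℝ V := convex_iInter fun m => (W m).2.cvx
  have hVcut : ∀ i j : Fin n, i ≠ j → ∀ p q : ℚ, ∃ a b : ℝ, (a ≠ 0 ∨ b ≠ 0) ∧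
      ∀ x ∈ V, 0 ≤ a * (x i - p) + b * (x j - q) := by
    intro i j hij p q
    obtain ⟨m, hm⟩ := hen (i, j, p, q)
    have := hS2 (en m) (W m)
    rw [hm] at this
    obtain ⟨a, b, hab, h⟩ := this hij
    refine ⟨a, b, hab, fun x hx => h x ?_⟩
    have h2 := Set.mem_iInter.1 hx (m + 1)
    rw [hWs, hm] at h2
    exact h2
  have hline : ∃ (i : Fin n) (p v : Fin n → ℝ), ∀ x ∈ V, x = p + x i • v := by
    by_cases hsub : V.Subsingleton
    · rcases V.eq_empty_or_nonempty with h0 | ⟨x, hx⟩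
      · exact ⟨⟨0, hn⟩, 0, 0, by simp [h0]⟩
      · refine ⟨⟨0, hn⟩, x, 0, fun y hy => ?_⟩
        rw [hsub hy hx]; simp
    · rw [Set.not_subsingleton_iff] at hsub
      obtain ⟨x, hx, y, hy, hxy⟩ := hsub
      obtain ⟨i, hi⟩ : ∃ i, x i ≠ y i := by
        by_contra! h
        exact hxy (funext h)
      have hi' : y i - x i ≠ 0 := sub_ne_zero.2 hi.symm
      refine ⟨i, fun j => x j - x i * ((y j - x j) / (y i - x i)), fun j => (y j - x j) / (y i - x i),
        fun z hz => ?_⟩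
      ext j
      have := line_of_cuts V hVc hVcut x y z hx hy hz i j
      simp only [Pi.add_apply, Pi.smul_apply, smul_eq_mul]
      field_simp
      linarith
  obtain ⟨i, p, v, hpv⟩ := hline
  have hUo : IsOpen {x : Fin n → ℝ | |Q x - Q (p + x i • v)| < e} :=
    isOpen_lt (by fun_prop) continuous_const
  obtain ⟨m, hm⟩ := exists_subset_nhds_of_isCompact (V := fun m => (W m).1)
    (hWa.directed_ge) (fun m => (W m).2.cpt)
    (U := {x : Fin n → ℝ | |Q x - Q (p + x i • v)| < e}) (by
      intro x hx
      apply hUo.mem_nhds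
      show |Q x - Q (p + x i • v)| < e
      rw [← hpv x hx]; simpa using he)
  exact ⟨(W m).1, (W m).2, i, p, v, fun x hx => hm hx⟩

end CW

namespace CW

/-- log-concavity of a distribution function -/
def LCf (F : ℝ → ℝ) : Prop :=
  ∀ s t l : ℝ, 0 < l → l < 1 → F s ^ (1 - l) * F t ^ l ≤ F ((1 - l) * s + l * t)

lemma LCf.neg {F : ℝ → ℝ} (h : LCf F) : LCf (fun t => F (-t)) := by
  intro s t l h0 h1
  have := h (-s) (-t) l h0 h1
  have e : -((1 - l) * s + l * t) = (1 - l) * -s + l * -t := by ring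
  simp only [e]; exact this

lemma dens1 (F : ℝ → ℝ) (hF : LCf F) (h0 : ∀ t, 0 ≤ F t) (h1 : ∀ t, F t ≤ 1) (hm : Monotone F)
    (hq : F (-1) = 1 / 4) (x y : ℝ) (hx : -1 < x) (hxy : x < y) :
    (1 + y) * (F y - F x) ≤ 2 * (y - x) := by
  have hFx : 0 < F x := by have := hm hx.le; rw [hq] at this; linarith
  have hFy : 0 < F y := lt_of_lt_of_le hFx (hm hxy.le)
  have hy : 0 < y + 1 := by linarith
  set l := (x + 1) / (y + 1) with hl
  have l0 : 0 < l := div_pos (by linarith) hy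
  have l1 : l < 1 := (div_lt_one hy).2 (by linarith)
  have hly : l * (y + 1) = x + 1 := div_mul_cancel₀ _ hy.ne'
  have h := hF (-1) y l l0 l1
  have e : (1 - l) * -1 + l * y = x := by linarith
  rw [e, hq] at h
  have hlog := Real.log_le_log (by positivity) h
  rw [Real.log_mul (by positivity) (by positivity), Real.log_rpow (by norm_num),
    Real.log_rpow hFy] at hlog
  have h4 : Real.log (1 / 4) = - (2 * Real.log 2) := by
    rw [one_div, Real.log_inv, show (4 : ℝ) = 2 ^ 2 by norm_num, Real.log_pow]; push_cast; ring
  have l2 := Real.log_two_lt_d9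
  have lFy : Real.log (F y) ≤ 0 := Real.log_nonpos hFy.le (h1 y)
  have key : F y - F x ≤ Real.log (F y) - Real.log (F x) := by
    have := Real.log_le_sub_one_of_pos (div_pos hFx hFy)
    rw [Real.log_div hFx.ne' hFy.ne'] at this
    have h3 : F y - F x ≤ 1 - F x / F y := by
      rw [show 1 - F x / F y = (F y - F x) / F y by field_simp]
      rw [le_div_iff₀ hFy]
      exact mul_le_of_le_one_right (by have := hm hxy.le; linarith) (h1 y)
    linarith
  have hlog2 : (1 - l) * Real.log (F y) ≤ 0 :=
    mul_nonpos_of_nonneg_of_nonpos (by linarith) lFy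
  have h5 : F y - F x ≤ (1 - l) * (2 * Real.log 2) := by
    rw [h4] at hlog; linarith
  have h6 : (1 - l) * (2 * Real.log 2) ≤ (1 - l) * 2 :=
    mul_le_mul_of_nonneg_left (by linarith) (by linarith)
  calc (1 + y) * (F y - F x) ≤ (1 + y) * ((1 - l) * 2) :=
        mul_le_mul_of_nonneg_left (h5.trans h6) (by linarith)
    _ = 2 * (y - x) := by linear_combination (-2) * hly

lemma tail1 (T : ℝ → ℝ) (hT : LCf T) (h0 : ∀ t, 0 ≤ T t) (h1 : ∀ t, T t ≤ 1)
    (hq : T (-1) = 3 / 4) (hq' : T 1 = 1 / 4) (k : ℕ) (hk : 1 ≤ k) :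
    T k ≤ (3 / 5) ^ (k + 1) := by
  rcases hk.eq_or_lt with rfl | hk
  · norm_num [hq']
  have hk' : (1 : ℝ) < k := by exact_mod_cast hk
  have hy : 0 < (k : ℝ) + 1 := by linarith
  set l := 2 / ((k : ℝ) + 1) with hl
  have l0 : 0 < l := by positivity
  have l1 : l < 1 := (div_lt_one hy).2 (by linarith)
  have hly : l * (k + 1) = 2 := div_mul_cancel₀ _ hy.ne'
  have h := hT (-1) k l l0 l1
  have e : (1 - l) * -1 + l * k = 1 := by linarith
  rw [e, hq, hq'] at h
  have h2 : (3 / 4 : ℝ) ≤ (3 / 4 : ℝ) ^ (1 - l) := by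
    conv_lhs => rw [← Real.rpow_one (3 / 4)]
    exact Real.rpow_le_rpow_of_exponent_ge (by norm_num) (by norm_num) (by linarith)
  have hTl : 0 ≤ T k ^ l := Real.rpow_nonneg (h0 _) _
  have h3 : T k ^ l ≤ 1 / 3 := by
    have := mul_le_mul_of_nonneg_right h2 hTl
    linarith
  have h4 : (T k ^ l) ^ (k + 1) ≤ (1 / 3 : ℝ) ^ (k + 1) := pow_le_pow_left₀ hTl h3 _
  rw [← Real.rpow_mul_natCast (h0 _)] at h4
  push_cast at h4
  rw [hly] at h4
  have h5 : T k ^ 2 ≤ ((3 / 5) ^ (k + 1)) ^ 2 := by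
    calc T k ^ 2 = T k ^ (2 : ℝ) := by norm_num
      _ ≤ (1 / 3 : ℝ) ^ (k + 1) := h4
      _ ≤ ((3 / 5) ^ 2) ^ (k + 1) := pow_le_pow_left₀ (by norm_num) (by norm_num) _
      _ = _ := by rw [← pow_mul, ← pow_mul, mul_comm]
  exact le_of_sq_le_sq h5 (by positivity)

lemma cont_Iic (ν : Measure ℝ) [IsFiniteMeasure ν] (ha : ∀ x, ν {x} = 0) :
    Continuous fun t => ν.real (Set.Iic t) := by
  have e : (fun t => ν.real (Set.Iic t)) = fun t => ∫ x, (Set.Iic t).indicator (fun _ => (1 : ℝ)) x ∂ν := by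
    ext t; rw [integral_indicator_const _ measurableSet_Iic]; simp
  rw [e, continuous_iff_continuousAt]
  intro t
  refine continuousAt_of_dominated (bound := fun _ => (1 : ℝ)) ?_ ?_ ?_ ?_
  · exact .of_forall fun s => (measurable_const.indicator measurableSet_Iic).aestronglyMeasurable
  · refine .of_forall fun s => .of_forall fun x => ?_
    refine (norm_indicator_le_norm_self _ _).trans (by simp)
  · exact integrable_const _
  · have h : ∀ᵐ x ∂ν, x ≠ t := by rw [ae_iff]; simpa using ha t
    filter_upwards [h] with x hx
    rcases lt_or_gt_of_ne hx with hx | hx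
    · refine (continuousAt_const (y := (1 : ℝ))).congr ?_
      filter_upwards [lt_mem_nhds hx] with s hs
      rw [Set.indicator_of_mem]; exact hs.le
    · refine (continuousAt_const (y := (0 : ℝ))).congr ?_
      filter_upwards [gt_mem_nhds hx] with s hs
      rw [Set.indicator_of_notMem]; exact not_le.2 hs

lemma quant (ν : Measure ℝ) [IsFiniteMeasure ν] (ha : ∀ x, ν {x} = 0) (A : Set ℝ)
    (hA : IsClosed A) (hAc : ν Aᶜ = 0) (v : ℝ) (h0 : 0 < v) (h1 : v < ν.real Set.univ) :
    ∃ x ∈ A, ν.real (Set.Iic x) = v := by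
  have hc := cont_Iic ν ha
  have hbot : Filter.Tendsto (fun t => ν.real (Set.Ici t)) Filter.atBot (nhds (ν.real Set.univ)) := by
    exact (ENNReal.tendsto_toReal (by simp)).comp (tendsto_measure_Ici_atBot ν)
  have htop : Filter.Tendsto (fun t => ν.real (Set.Iic t)) Filter.atTop (nhds (ν.real Set.univ)) := by
    exact (ENNReal.tendsto_toReal (by simp)).comp (tendsto_measure_Iic_atTop ν)
  have hmono : Monotone fun t => ν.real (Set.Iic t) := fun s t hst =>
    measureReal_mono (Set.Iic_subset_Iic.2 hst)
  obtain ⟨b, hb⟩ : ∃ b, ν.real (Set.Iic b) < v := by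
    obtain ⟨t, ht⟩ := (hbot.eventually (lt_mem_nhds (show ν.real Set.univ - v < ν.real Set.univ by
      linarith))).exists
    refine ⟨t - 1, ?_⟩
    have h2 := measureReal_compl (μ := ν) (measurableSet_Ici (a := t))
    have h3 : ν.real (Set.Iic (t - 1)) ≤ ν.real (Set.Ici t)ᶜ := by
      refine measureReal_mono ?_ (measure_ne_top _ _)
      intro x hx
      have : x ≤ t - 1 := hx
      exact not_le.2 (show x < t by linarith)
    linarith
  obtain ⟨c, hc'⟩ := (htop.eventually (lt_mem_nhds h1)).exists
  set S := {t | ν.real (Set.Iic t) = v} with hS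
  have hSc : IsClosed S := isClosed_eq hc continuous_const
  have hSn : S.Nonempty := mem_range_of_exists_le_of_exists_ge hc ⟨b, hb.le⟩ ⟨c, hc'.le⟩
  have hSb : BddBelow S := by
    refine ⟨b, fun t ht => ?_⟩
    by_contra! hlt
    have := hmono hlt.le
    have ht : ν.real (Set.Iic t) = v := ht
    simp only at this
    linarith
  have hmem := hSc.csInf_mem hSn hSb
  refine ⟨sInf S, ?_, hmem⟩
  by_contra hx
  obtain ⟨l, hl, hls⟩ := exists_Ioc_subset_of_mem_nhds (hA.isOpen_compl.mem_nhds hx) ⟨sInf S - 1, by linarith⟩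
  have : l ∈ S := by
    have hmem : ν.real (Set.Iic (sInf S)) = v := hmem
    show ν.real (Set.Iic l) = v
    rw [← hmem]
    apply measureReal_congr
    have : ∀ᵐ x ∂ν, x ∈ A := by rw [ae_iff]; exact hAc
    filter_upwards [this] with x hxA
    refine propext ?_
    show x ≤ l ↔ x ≤ sInf S
    refine ⟨fun h => h.trans hl.le, fun h => ?_⟩
    by_contra! h2
    exact hls ⟨h2, h⟩ hxA
  exact absurd (csInf_le hSb this) (not_le.2 hl)

/-- normalized measure -/
structure Nrm (μ : Measure ℝ) : Prop where
  atom : ∀ x, μ {x} = 0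
  lcF : LCf fun t => μ.real (Set.Iic t)
  lcT : LCf fun t => μ.real (Set.Ici t)

lemma Nrm.compl {μ : Measure ℝ} [IsProbabilityMeasure μ] (h : Nrm μ) (t : ℝ) :
    μ.real (Set.Ici t) = 1 - μ.real (Set.Iic t) := by
  rw [← Set.compl_Iio, measureReal_compl measurableSet_Iio]
  simp only [probReal_univ]
  congr 1
  apply measureReal_congr
  have : ∀ᵐ x ∂μ, x ≠ t := by rw [ae_iff]; simpa using h.atom t
  filter_upwards [this] with x hx
  exact propext ⟨fun h => le_of_lt h, fun h => lt_of_le_of_ne h hx⟩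

lemma Nrm.dens {μ : Measure ℝ} [IsProbabilityMeasure μ] (h : Nrm μ)
    (hF : μ.real (Set.Iic (-1)) = 1 / 4) (hT : μ.real (Set.Ici 1) = 1 / 4)
    (x y : ℝ) (hxy : x < y) :
    (1 + |x|) * (μ.real (Set.Iic y) - μ.real (Set.Iic x)) ≤ 2 * (y - x) ∧
    (1 + |y|) * (μ.real (Set.Iic y) - μ.real (Set.Iic x)) ≤ 2 * (y - x) := by
  have hm : Monotone fun t => μ.real (Set.Iic t) := fun s t hst =>
    measureReal_mono (Set.Iic_subset_Iic.2 hst)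
  have hm' : Monotone fun t => μ.real (Set.Ici (-t)) := fun s t hst =>
    measureReal_mono (Set.Ici_subset_Ici.2 (by linarith))
  have d1 : -1 < x → (1 + y) * (μ.real (Set.Iic y) - μ.real (Set.Iic x)) ≤ 2 * (y - x) := fun hx =>
    dens1 (fun t => μ.real (Set.Iic t)) h.lcF (fun _ => measureReal_nonneg) (fun _ => measureReal_le_one)
      hm hF x y hx hxy
  have d2 : y < 1 → (1 - x) * (μ.real (Set.Iic y) - μ.real (Set.Iic x)) ≤ 2 * (y - x) := fun hx => by
    have := dens1 (fun t => μ.real (Set.Ici (-t))) h.lcT.neg (fun _ => measureReal_nonneg)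
      (fun _ => measureReal_le_one) hm' (by simpa using hT) (-y) (-x) (by linarith) (by linarith)
    simp only [neg_neg, h.compl] at this
    linarith
  have hxy' := hm hxy.le
  simp only at hxy'
  have m1 : μ.real (Set.Iic y) ≤ 1 := measureReal_le_one
  have m2 : 0 ≤ μ.real (Set.Iic x) := measureReal_nonneg
  set m := μ.real (Set.Iic y) - μ.real (Set.Iic x) with hmdef
  have hm0 : 0 ≤ m := by linarith
  have hm1 : m ≤ 1 := by linarith
  suffices H : ∃ B, |x| ≤ B ∧ |y| ≤ B ∧ (1 + B) * m ≤ 2 * (y - x) by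
    obtain ⟨B, b1, b2, b3⟩ := H
    constructor
    · exact (mul_le_mul_of_nonneg_right (by linarith) hm0).trans b3
    · exact (mul_le_mul_of_nonneg_right (by linarith) hm0).trans b3
  rcases le_or_gt 0 x with hx | hx
  · exact ⟨y, by rw [abs_of_nonneg hx]; linarith, by rw [abs_of_nonneg (by linarith)], d1 (by linarith)⟩
  rcases le_or_gt y 0 with hy | hy
  · exact ⟨-x, by rw [abs_of_neg hx], by rw [abs_of_nonpos hy]; linarith, d2 (by linarith)⟩
  rw [abs_of_neg hx, abs_of_pos hy]
  by_cases hc : 1 ≤ y - x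
  · refine ⟨y - x, by linarith, by linarith, ?_⟩
    calc (1 + (y - x)) * m ≤ (1 + (y - x)) * 1 := mul_le_mul_of_nonneg_left hm1 (by linarith)
      _ ≤ _ := by linarith
  · push Not at hc
    rcases le_total (-x) y with h2 | h2
    · exact ⟨y, h2, le_rfl, d1 (by linarith)⟩
    · exact ⟨-x, le_rfl, h2, d2 (by linarith)⟩

lemma Nrm.expm {μ : Measure ℝ} [IsProbabilityMeasure μ] (h : Nrm μ)
    (hF : μ.real (Set.Iic (-1)) = 1 / 4) (hT : μ.real (Set.Ici 1) = 1 / 4) :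
    Integrable (fun x => (5 / 4 : ℝ) ^ |x|) μ ∧ ∫ x, (5 / 4 : ℝ) ^ |x| ∂μ ≤ 6 := by
  have hT' : μ.real (Set.Ici (-1)) = 3 / 4 := by rw [h.compl, hF]; norm_num
  have hF' : μ.real (Set.Iic 1) = 3 / 4 := by have := h.compl 1; linarith
  have tl : ∀ k : ℕ, μ.real {x | (k : ℝ) ≤ |x|} ≤ 2 * (3 / 5) ^ (k + 1) := by
    intro k
    rcases Nat.eq_zero_or_pos k with rfl | hk
    · refine measureReal_le_one.trans (by norm_num)
    · have t1 := tail1 (fun t => μ.real (Set.Ici t)) h.lcT (fun _ => measureReal_nonneg)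
        (fun _ => measureReal_le_one) hT' hT k hk
      have t2 := tail1 (fun t => μ.real (Set.Iic (-t))) h.lcF.neg (fun _ => measureReal_nonneg)
        (fun _ => measureReal_le_one) (by simpa using hF') (by simpa using hF) k hk
      have : {x : ℝ | (k : ℝ) ≤ |x|} ⊆ Set.Ici (k : ℝ) ∪ Set.Iic (-(k : ℝ)) := by
        intro x hx
        rcases le_abs.1 (show (k : ℝ) ≤ |x| from hx) with h | h
        · exact Or.inl h
        · exact Or.inr (show x ≤ -k by linarith)
      have := (measureReal_mono this (μ := μ)).trans (measureReal_union_le _ _)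
      linarith
  have hmeas : Measurable fun x : ℝ => (5 / 4 : ℝ) ^ |x| := by fun_prop
  have hset : ∀ k : ℕ, MeasurableSet {x : ℝ | (k : ℝ) ≤ |x|} := fun k =>
    measurableSet_le measurable_const (by fun_prop)
  have hle : ∫⁻ x, ENNReal.ofReal ((5 / 4 : ℝ) ^ |x|) ∂μ ≤ ENNReal.ofReal 6 := by
    calc ∫⁻ x, ENNReal.ofReal ((5 / 4 : ℝ) ^ |x|) ∂μ
        ≤ ∫⁻ x, ∑' k : ℕ, {x : ℝ | (k : ℝ) ≤ |x|}.indicator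
            (fun _ => ENNReal.ofReal ((5 / 4) ^ (k + 1))) x ∂μ := by
          apply lintegral_mono
          intro x
          refine le_trans ?_ (ENNReal.le_tsum ⌊|x|⌋₊)
          rw [Set.indicator_of_mem (show x ∈ {y : ℝ | ((⌊|x|⌋₊ : ℕ) : ℝ) ≤ |y|} from
            Nat.floor_le (abs_nonneg x))]
          apply ENNReal.ofReal_le_ofReal
          rw [← Real.rpow_natCast]
          apply Real.rpow_le_rpow_of_exponent_le (by norm_num)
          push_cast
          exact (Nat.lt_floor_add_one |x|).le
      _ = ∑' k : ℕ, ENNReal.ofReal ((5 / 4) ^ (k + 1)) * μ {x : ℝ | (k : ℝ) ≤ |x|} := by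
          rw [lintegral_tsum]
          · congr 1; ext k
            rw [lintegral_indicator_const (hset k)]
          · intro k
            exact (measurable_const.indicator (hset k)).aemeasurable
      _ ≤ ∑' k : ℕ, ENNReal.ofReal (3 / 2 * (3 / 4) ^ k) := by
          apply ENNReal.tsum_le_tsum
          intro k
          rw [← ofReal_measureReal, ← ENNReal.ofReal_mul (by positivity)]
          apply ENNReal.ofReal_le_ofReal
          calc (5 / 4 : ℝ) ^ (k + 1) * μ.real {x | (k : ℝ) ≤ |x|}
              ≤ (5 / 4 : ℝ) ^ (k + 1) * (2 * (3 / 5) ^ (k + 1)) :=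
                mul_le_mul_of_nonneg_left (tl k) (by positivity)
            _ = 2 * ((5 / 4) * (3 / 5)) ^ (k + 1) := by rw [mul_pow]; ring
            _ = _ := by norm_num [pow_succ]; ring
      _ = ENNReal.ofReal 6 := by
          rw [← ENNReal.ofReal_tsum_of_nonneg (fun k => by positivity)
            ((summable_geometric_of_lt_one (by norm_num) (by norm_num)).mul_left _),
            tsum_mul_left, tsum_geometric_of_lt_one (by norm_num) (by norm_num)]
          norm_num
  have hn : ∀ x : ℝ, 0 ≤ (5 / 4 : ℝ) ^ |x| := fun x => by positivity
  constructor
  · refine ⟨hmeas.aestronglyMeasurable, ?_⟩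
    rw [hasFiniteIntegral_iff_ofReal (.of_forall hn)]
    exact lt_of_le_of_lt hle ENNReal.ofReal_lt_top
  · rw [integral_eq_lintegral_of_nonneg_ae (.of_forall hn) hmeas.aestronglyMeasurable]
    exact ENNReal.toReal_le_of_le_ofReal (by norm_num) hle

lemma pow_le_exp54 (d : ℕ) (hd : 1 ≤ d) (x : ℝ) :
    (1 + |x|) ^ (2 * d) ≤ (10 * d) ^ (2 * d) * (5 / 4) * (5 / 4 : ℝ) ^ |x| := by
  have hs : (1 : ℝ) / 5 ≤ Real.log (5 / 4) := by
    have := Real.one_sub_inv_le_log_of_pos (show (0 : ℝ) < 5 / 4 by norm_num)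
    norm_num at this ⊢; linarith
  set s := Real.log (5 / 4)
  have hx := abs_nonneg x
  have h := Real.pow_div_factorial_le_exp (s * (1 + |x|)) (by positivity) (2 * d)
  have e : Real.exp (s * (1 + |x|)) = (5 / 4) * (5 / 4 : ℝ) ^ |x| := by
    rw [mul_add, Real.exp_add, mul_one, Real.exp_log (by norm_num), Real.rpow_def_of_pos (by norm_num)]
  rw [e, div_le_iff₀ (by positivity), mul_pow] at h
  have h2 : (1 / 5 : ℝ) ^ (2 * d) ≤ s ^ (2 * d) := pow_le_pow_left₀ (by norm_num) hs _
  have h3 : (((2 * d).factorial : ℕ) : ℝ) ≤ (2 * d) ^ (2 * d) := by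
    exact_mod_cast Nat.factorial_le_pow (2 * d)
  have hp : 0 ≤ (1 + |x|) ^ (2 * d) := by positivity
  have hq : 0 ≤ (5 / 4) * (5 / 4 : ℝ) ^ |x| := by positivity
  calc (1 + |x|) ^ (2 * d) = 5 ^ (2 * d) * ((1 / 5 : ℝ) ^ (2 * d) * (1 + |x|) ^ (2 * d)) := by
        rw [← mul_assoc, ← mul_pow]; norm_num
    _ ≤ 5 ^ (2 * d) * (s ^ (2 * d) * (1 + |x|) ^ (2 * d)) := by gcongr
    _ ≤ 5 ^ (2 * d) * ((5 / 4) * (5 / 4 : ℝ) ^ |x| * (2 * d) ^ (2 * d)) := by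
        refine mul_le_mul_of_nonneg_left (h.trans ?_) (by positivity)
        exact mul_le_mul_of_nonneg_left h3 hq
    _ = _ := by
        rw [show (10 * d : ℝ) = 5 * (2 * d) by ring, mul_pow 5 (2 * (d : ℝ))]; ring

lemma prod_dist (i d : ℕ) (h : i ≤ d) :
    ∏ j ∈ (Finset.range (d + 1)).erase i, |(i : ℝ) - j| = i.factorial * (d - i).factorial := by
  induction d, h using Nat.le_induction with
  | base =>
    rw [Finset.range_add_one, Finset.erase_insert (by simp)]
    simp only [Nat.sub_self, Nat.factorial_zero, Nat.cast_one, mul_one]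
    rw [← Finset.prod_range_add_one_eq_factorial, ← Finset.prod_range_reflect]
    push_cast
    apply Finset.prod_congr rfl
    intro j hj
    have hj := Finset.mem_range.1 hj
    have hji : (j : ℝ) < i := by exact_mod_cast hj
    have : ((i - 1 - j : ℕ) : ℝ) = i - 1 - j := by
      rw [Nat.cast_sub (by omega), Nat.cast_sub (by omega)]; simp
    rw [this, show (i : ℝ) - (i - 1 - j) = j + 1 by ring, abs_of_pos (by positivity)]
  | succ d hd ih =>
    rw [Finset.range_add_one, Finset.erase_insert_of_ne (by omega), Finset.prod_insert (by simp), ih,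
      Nat.succ_sub hd, Nat.factorial_succ]
    push_cast
    rw [Nat.cast_sub hd, abs_sub_comm, abs_of_nonneg (by
      have : (i : ℝ) ≤ d := by exact_mod_cast hd
      linarith)]
    ring

lemma fact_bound (d i : ℕ) (h : i ≤ d) :
    (d.factorial : ℝ) ≤ 2 ^ d * (i.factorial * (d - i).factorial) := by
  rw [← Nat.choose_mul_factorial_mul_factorial h]
  push_cast
  rw [mul_assoc]
  apply mul_le_mul_of_nonneg_right _ (by positivity)
  exact_mod_cast Nat.choose_le_two_pow d i

lemma pow_fact (d : ℕ) : (d : ℝ) ^ d ≤ 3 ^ d * d.factorial := by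
  have h := Real.pow_div_factorial_le_exp (d : ℝ) (by positivity) d
  rw [div_le_iff₀ (by positivity)] at h
  refine h.trans (mul_le_mul_of_nonneg_right ?_ (by positivity))
  rw [← Real.exp_one_pow]
  have := Real.exp_one_lt_d9
  exact pow_le_pow_left₀ (Real.exp_nonneg _) (by linarith) _

/-- Lagrange interpolation bound -/
lemma lag (d : ℕ) (hd : 1 ≤ d) (q : Polynomial ℝ) (hq : q.natDegree ≤ d) (x : ℕ → ℝ) (a α : ℝ)
    (ha : 0 < a) (hα : 0 < α)
    (hx : ∀ i j, i ≤ d → j ≤ d → i ≠ j →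
      (1 + |x j|) * (a * |(i : ℝ) - j| / (d + 2)) ≤ 2 * |x i - x j|)
    (hqx : ∀ i ≤ d, |q.eval (x i)| ≤ α) (X : ℝ) :
    |q.eval X| ≤ α * (72 * (1 + |X|) / a) ^ d := by
  have hne : ∀ i j, i ≤ d → j ≤ d → i ≠ j → 0 < |x i - x j| := by
    intro i j hi hj hij
    have h := hx i j hi hj hij
    have : 0 < |(i : ℝ) - j| := abs_pos.2 (sub_ne_zero.2 (by exact_mod_cast hij))
    have h0 := abs_nonneg (x j)
    have : 0 < (1 + |x j|) * (a * |(i : ℝ) - j| / (d + 2)) := by positivity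
    linarith
  have hinj : Set.InjOn x (Finset.range (d + 1)) := by
    intro i hi j hj hij
    by_contra h
    have := hne i j (by simpa [Nat.lt_succ_iff] using hi) (by simpa [Nat.lt_succ_iff] using hj) h
    rw [hij] at this; simp at this
  have hdeg : q.degree < (Finset.range (d + 1)).card := by
    rw [Finset.card_range]
    exact lt_of_le_of_lt Polynomial.degree_le_natDegree (by exact_mod_cast Nat.lt_succ_of_le hq)
  have hX := abs_nonneg X
  have hb : ∀ i ≤ d, |(Lagrange.basis (Finset.range (d + 1)) x i).eval X| ≤
      ((1 + |X|) * (2 * (d + 2)) / a) ^ d * (2 ^ d / d.factorial) := by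
    intro i hi
    rw [Lagrange.basis, Polynomial.eval_prod, Finset.abs_prod]
    calc ∏ j ∈ (Finset.range (d + 1)).erase i, |(Lagrange.basisDivisor (x i) (x j)).eval X|
        ≤ ∏ j ∈ (Finset.range (d + 1)).erase i,
          (((1 + |X|) * (2 * (d + 2)) / a) * |(i : ℝ) - j|⁻¹) := by
          apply Finset.prod_le_prod
          · intros; positivity
          · intro j hj
            rw [Finset.mem_erase, Finset.mem_range] at hj
            have hj' : j ≤ d := by omega
            have h1 := hx i j hi hj' (Ne.symm hj.1)
            have h2 := hne i j hi hj' (Ne.symm hj.1)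
            have h3 : 0 < |(i : ℝ) - j| :=
              abs_pos.2 (sub_ne_zero.2 (by exact_mod_cast (Ne.symm hj.1)))
            have h4 := abs_nonneg (x j)
            simp only [Lagrange.basisDivisor, Polynomial.eval_mul, Polynomial.eval_C,
              Polynomial.eval_sub, Polynomial.eval_X, abs_mul, abs_inv]
            have h5 : |X - x j| ≤ (1 + |X|) * (1 + |x j|) := by
              have := abs_sub X (x j)
              have := mul_nonneg hX h4
              linarith
            rw [inv_mul_le_iff₀ h2]
            refine h5.trans ?_
            have h6 : (1 + |x j|) ≤ 2 * |x i - x j| * ((d + 2) / (a * |(i : ℝ) - j|)) := by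
              have h7 : 0 < (d + 2 : ℝ) / (a * |(i : ℝ) - j|) := by positivity
              calc (1 + |x j|) = (1 + |x j|) * (a * |(i : ℝ) - j| / (d + 2)) *
                    ((d + 2) / (a * |(i : ℝ) - j|)) := by field_simp
                _ ≤ _ := mul_le_mul_of_nonneg_right h1 h7.le
            calc (1 + |X|) * (1 + |x j|) ≤ (1 + |X|) * (2 * |x i - x j| * ((d + 2) / (a * |(i : ℝ) - j|))) :=
                  mul_le_mul_of_nonneg_left h6 (by linarith)
              _ = _ := by field_simp
      _ = ((1 + |X|) * (2 * (d + 2)) / a) ^ d * (i.factorial * (d - i).factorial : ℝ)⁻¹ := by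
          rw [Finset.prod_mul_distrib, Finset.prod_const, Finset.card_erase_of_mem
            (by rw [Finset.mem_range]; omega), Finset.card_range, Nat.add_sub_cancel,
            Finset.prod_inv_distrib, prod_dist i d hi]
      _ ≤ _ := by
          apply mul_le_mul_of_nonneg_left _ (by positivity)
          have := fact_bound d i hi
          rw [inv_eq_one_div, div_le_div_iff₀ (by positivity) (by positivity)]
          linarith
  have hd' : (1 : ℝ) ≤ d := by exact_mod_cast hd
  rw [Lagrange.eq_interpolate hinj hdeg, Lagrange.interpolate_apply, Polynomial.eval_finsetSum]
  refine (Finset.abs_sum_le_sum_abs _ _).trans ?_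
  calc ∑ i ∈ Finset.range (d + 1), |(Polynomial.C (q.eval (x i)) *
          Lagrange.basis (Finset.range (d + 1)) x i).eval X|
      ≤ ∑ i ∈ Finset.range (d + 1), α * (((1 + |X|) * (2 * (d + 2)) / a) ^ d * (2 ^ d / d.factorial)) := by
        apply Finset.sum_le_sum
        intro i hi
        have hi' : i ≤ d := by rw [Finset.mem_range] at hi; omega
        rw [Polynomial.eval_mul, Polynomial.eval_C, abs_mul]
        exact mul_le_mul (hqx i hi') (hb i hi') (abs_nonneg _) hα.le
    _ = (d + 1) * (α * (((1 + |X|) * (2 * (d + 2)) / a) ^ d * (2 ^ d / d.factorial))) := by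
        rw [Finset.sum_const, Finset.card_range, nsmul_eq_mul]; push_cast; ring
    _ ≤ 2 ^ d * (α * (((1 + |X|) * (2 * (3 * d)) / a) ^ d * (2 ^ d / d.factorial))) := by
        have h1 : (d + 1 : ℝ) ≤ 2 ^ d := by exact_mod_cast Nat.lt_two_pow_self
        gcongr
        linarith
    _ = α * (24 * (1 + |X|) / a) ^ d * (d ^ d / d.factorial) := by
        rw [show (1 + |X|) * (2 * (3 * (d : ℝ))) / a = (6 * (1 + |X|) / a) * d by ring,
          show 24 * (1 + |X|) / a = 2 * 2 * (6 * (1 + |X|) / a) by ring, mul_pow, mul_pow (2 * 2 : ℝ), mul_pow 2]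
        ring
    _ ≤ α * (24 * (1 + |X|) / a) ^ d * 3 ^ d := by
        have := pow_fact d
        gcongr
        rw [div_le_iff₀ (by positivity)]; exact this
    _ = _ := by rw [mul_assoc, ← mul_pow]; ring_nf

/-- one-dimensional inequality, normalized -/
lemma oned_norm {μ : Measure ℝ} [IsProbabilityMeasure μ] (h : Nrm μ)
    (hF : μ.real (Set.Iic (-1)) = 1 / 4) (hT : μ.real (Set.Ici 1) = 1 / 4)
    (d : ℕ) (hd : 1 ≤ d) (q : Polynomial ℝ) (hq : q.natDegree ≤ d) (α : ℝ) (hα : 0 < α) :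
    μ.real {x | |q.eval x| ≤ α} ^ (2 * d) * ∫ x, (q.eval x) ^ 2 ∂μ ≤ α ^ 2 * (5760 * d) ^ (2 * d) := by
  set A : Set ℝ := {x | |q.eval x| ≤ α} with hA
  have hAcl : IsClosed A := isClosed_le (by fun_prop) continuous_const
  set a := μ.real A with ha
  have hd' : (1 : ℝ) ≤ d := by exact_mod_cast hd
  rcases (measureReal_nonneg (μ := μ) (s := A)).eq_or_lt with h0 | h0
  · rw [ha, ← h0, zero_pow (by omega), zero_mul]; positivity
  rw [← ha] at h0
  have hpt : ∀ i : ℕ, ∃ x, i ≤ d → x ∈ A ∧ (μ.restrict A).real (Set.Iic x) = a * (i + 1) / (d + 2) := by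
    intro i
    by_cases hi : i ≤ d
    · have hi' : (i : ℝ) ≤ d := by exact_mod_cast hi
      obtain ⟨x, hx, hx'⟩ := quant (μ.restrict A)
        (fun x => Measure.restrict_apply_eq_zero' hAcl.measurableSet |>.2
          (measure_mono_null Set.inter_subset_left (h.atom x))) A hAcl
        (by rw [Measure.restrict_apply hAcl.measurableSet.compl]; simp)
        (a * (i + 1) / (d + 2)) (by positivity) (by
          rw [measureReal_restrict_apply MeasurableSet.univ, Set.univ_inter, ← ha,
            div_lt_iff₀ (by positivity)]
          exact mul_lt_mul_of_pos_left (by linarith) h0)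
      exact ⟨x, fun _ => ⟨hx, hx'⟩⟩
    · exact ⟨0, fun h => absurd h hi⟩
  choose x hx using hpt
  have hm : Monotone fun t => (μ.restrict A).real (Set.Iic t) := fun s t hst =>
    measureReal_mono (Set.Iic_subset_Iic.2 hst)
  have hlt : ∀ i j, i < j → j ≤ d → x i < x j := by
    intro i j hij hj
    by_contra! hc
    have := hm hc
    simp only [(hx i (by omega)).2, (hx j hj).2] at this
    rw [div_le_div_iff_of_pos_right (by positivity)] at this
    have := le_of_mul_le_mul_left this h0
    have : (i : ℝ) < j := by exact_mod_cast hij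
    linarith
  have hdiff : ∀ s t, s ≤ t → (μ.restrict A).real (Set.Iic t) - (μ.restrict A).real (Set.Iic s) ≤
      μ.real (Set.Iic t) - μ.real (Set.Iic s) := by
    intro s t hst
    have e1 := measureReal_sdiff (μ := μ) (Set.Iic_subset_Iic.2 hst) measurableSet_Iic
    have e2 := measureReal_sdiff (μ := μ.restrict A) (Set.Iic_subset_Iic.2 hst) measurableSet_Iic
    rw [← e1, ← e2]
    exact ENNReal.toReal_mono (measure_ne_top _ _) (Measure.restrict_apply_le _ _)
  have hgap : ∀ i j, i < j → j ≤ d → a * |(i : ℝ) - j| / (d + 2) ≤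
      μ.real (Set.Iic (x j)) - μ.real (Set.Iic (x i)) := by
    intro i j hij hj
    refine le_trans (le_of_eq ?_) (hdiff _ _ (hlt i j hij hj).le)
    rw [(hx i (by omega)).2, (hx j hj).2, abs_sub_comm, abs_of_pos (by
      have : (i : ℝ) < j := by exact_mod_cast hij
      linarith)]
    ring
  have hbound := lag d hd q hq x a α h0 hα (by
    intro i j hi hj hij
    rcases lt_or_gt_of_ne hij with hij | hij
    · have g1 := hgap i j hij hj
      have g2 := (h.dens hF hT (x i) (x j) (hlt i j hij hj)).2
      rw [abs_sub_comm (x i), abs_of_pos (sub_pos.2 (hlt i j hij hj))]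
      exact (mul_le_mul_of_nonneg_left g1 (by positivity)).trans g2
    · have g1 := hgap j i hij hi
      have g2 := (h.dens hF hT (x j) (x i) (hlt j i hij hi)).1
      rw [abs_of_pos (sub_pos.2 (hlt j i hij hi)), abs_sub_comm (i : ℝ)]
      exact (mul_le_mul_of_nonneg_left g1 (by positivity)).trans g2)
    (fun i hi => (hx i hi).1)
  obtain ⟨i1, i2⟩ := h.expm hF hT
  set B : ℝ := α ^ 2 * (72 / a) ^ (2 * d) * ((10 * d) ^ (2 * d) * (5 / 4)) with hB
  have hpw : ∀ X, (q.eval X) ^ 2 ≤ B * (5 / 4 : ℝ) ^ |X| := by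
    intro X
    have h1 := pow_le_pow_left₀ (abs_nonneg _) (hbound X) 2
    rw [sq_abs] at h1
    have h2 := pow_le_exp54 d hd X
    calc (q.eval X) ^ 2 ≤ (α * (72 * (1 + |X|) / a) ^ d) ^ 2 := h1
      _ = α ^ 2 * (72 / a) ^ (2 * d) * (1 + |X|) ^ (2 * d) := by
        rw [show 72 * (1 + |X|) / a = (72 / a) * (1 + |X|) by ring, mul_pow, mul_pow, mul_pow,
          ← pow_mul, ← pow_mul, mul_comm d 2]; ring
      _ ≤ α ^ 2 * (72 / a) ^ (2 * d) * ((10 * d) ^ (2 * d) * (5 / 4) * (5 / 4 : ℝ) ^ |X|) := by gcongr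
      _ = _ := by rw [hB]; ring
  have hB0 : 0 ≤ B := by positivity
  have hintg : ∫ x, (q.eval x) ^ 2 ∂μ ≤ B * 6 := by
    calc ∫ x, (q.eval x) ^ 2 ∂μ ≤ ∫ x, B * (5 / 4 : ℝ) ^ |x| ∂μ :=
          integral_mono_of_nonneg (.of_forall fun _ => sq_nonneg _) (i1.const_mul B) (.of_forall hpw)
      _ = B * ∫ x, (5 / 4 : ℝ) ^ |x| ∂μ := integral_const_mul _ _
      _ ≤ _ := mul_le_mul_of_nonneg_left i2 hB0
  calc a ^ (2 * d) * ∫ x, (q.eval x) ^ 2 ∂μ ≤ a ^ (2 * d) * (B * 6) := by gcongr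
    _ = α ^ 2 * ((a * (72 / a)) ^ (2 * d) * (10 * d) ^ (2 * d) * (15 / 2)) := by rw [hB, mul_pow a]; ring
    _ = α ^ 2 * ((720 * d) ^ (2 * d) * (15 / 2)) := by
        rw [mul_div_cancel₀ _ h0.ne', ← mul_pow]; ring_nf
    _ ≤ α ^ 2 * ((720 * d) ^ (2 * d) * 8 ^ (2 * d)) := by
        have : (15 / 2 : ℝ) ≤ 8 ^ (2 * d) := by
          calc (15 / 2 : ℝ) ≤ 8 ^ 1 := by norm_num
            _ ≤ _ := pow_le_pow_right₀ (by norm_num) (by omega)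
        gcongr
    _ = _ := by rw [← mul_pow]; ring_nf

/-- one-dimensional inequality -/
lemma oned {μ : Measure ℝ} [IsProbabilityMeasure μ] (h : Nrm μ)
    (d : ℕ) (hd : 1 ≤ d) (q : Polynomial ℝ) (hq : q.natDegree ≤ d) (α : ℝ) (hα : 0 < α) :
    μ.real {x | |q.eval x| ≤ α} ^ (2 * d) * ∫ x, (q.eval x) ^ 2 ∂μ ≤ α ^ 2 * (5760 * d) ^ (2 * d) := by
  obtain ⟨u, -, hu⟩ := quant μ h.atom Set.univ isClosed_univ (by simp) (1 / 4) (by norm_num)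
    (by simp; norm_num)
  obtain ⟨v, -, hv⟩ := quant μ h.atom Set.univ isClosed_univ (by simp) (3 / 4) (by norm_num)
    (by simp; norm_num)
  have huv : u < v := by
    by_contra! hc
    have := measureReal_mono (μ := μ) (Set.Iic_subset_Iic.2 hc)
    rw [hu, hv] at this
    norm_num at this
  set r := (v - u) / 2 with hr
  set c := (u + v) / 2 with hc
  have hr0 : 0 < r := by rw [hr]; linarith
  set f : ℝ → ℝ := fun x => (x - c) / r with hf
  have hfm : Measurable f := by rw [hf]; fun_prop
  have hfm' : AEMeasurable f μ := hfm.aemeasurable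
  have pI : ∀ t, f ⁻¹' (Set.Iic t) = Set.Iic (r * t + c) := by
    intro t; ext x
    simp only [hf, Set.mem_preimage, Set.mem_Iic, div_le_iff₀ hr0]
    constructor <;> intro h <;> linarith
  have pT : ∀ t, f ⁻¹' (Set.Ici t) = Set.Ici (r * t + c) := by
    intro t; ext x
    simp only [hf, Set.mem_preimage, Set.mem_Ici, le_div_iff₀ hr0]
    constructor <;> intro h <;> linarith
  have mI : ∀ t, (μ.map f).real (Set.Iic t) = μ.real (Set.Iic (r * t + c)) := fun t => by
    rw [map_measureReal_apply hfm measurableSet_Iic, pI]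
  have mT : ∀ t, (μ.map f).real (Set.Ici t) = μ.real (Set.Ici (r * t + c)) := fun t => by
    rw [map_measureReal_apply hfm measurableSet_Ici, pT]
  have hp : IsProbabilityMeasure (μ.map f) := Measure.isProbabilityMeasure_map hfm'
  have e : ∀ s t l, r * ((1 - l) * s + l * t) + c = (1 - l) * (r * s + c) + l * (r * t + c) := by
    intros; ring
  have hN : Nrm (μ.map f) := by
    refine ⟨?_, ?_, ?_⟩
    · intro x
      rw [Measure.map_apply hfm (measurableSet_singleton x)]
      refine measure_mono_null (t := {r * x + c}) ?_ (h.atom _)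
      intro y hy
      have : (y - c) / r = x := hy
      rw [div_eq_iff hr0.ne'] at this
      show y = r * x + c
      linarith
    · intro s t l h0 h1
      simp only [mI, e]
      exact h.lcF _ _ l h0 h1
    · intro s t l h0 h1
      simp only [mT, e]
      exact h.lcT _ _ l h0 h1
  set q' : Polynomial ℝ := q.comp (Polynomial.C r * Polynomial.X + Polynomial.C c) with hq'
  have hdeg : q'.natDegree ≤ d := by
    refine Polynomial.natDegree_comp_le.trans ?_
    calc q.natDegree * _ ≤ d * 1 := Nat.mul_le_mul hq Polynomial.natDegree_linear_le
      _ = d := mul_one d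
  have hev : ∀ x, q'.eval (f x) = q.eval x := by
    intro x
    simp only [hq', hf, Polynomial.eval_comp, Polynomial.eval_add, Polynomial.eval_mul,
      Polynomial.eval_C, Polynomial.eval_X]
    rw [mul_div_cancel₀ _ hr0.ne', sub_add_cancel]
  have H := oned_norm hN (by rw [mI, ← hu]; congr 2; rw [hr, hc]; ring)
    (by rw [mT, h.compl, show r * 1 + c = v by rw [hr, hc]; ring, hv]; norm_num) d hd q' hdeg α hα
  rw [integral_map hfm' (by
    exact Continuous.aestronglyMeasurable (by fun_prop)), map_measureReal_apply hfm
    (isClosed_le (by fun_prop) continuous_const).measurableSet] at H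
  simpa only [Set.preimage_ofPred_eq, hev] using H

end CW

namespace CW

lemma cond_real_apply' {Ω : Type*} [MeasurableSpace Ω] (μ : Measure Ω) {s : Set Ω}
    (hs : MeasurableSet s) (t : Set Ω) :
    (cond μ s).real t = (μ.real s)⁻¹ * μ.real (s ∩ t) := by
  simp only [Measure.real, cond_apply hs, ENNReal.toReal_mul, ENNReal.toReal_inv]

lemma nrm_cond (n : ℕ) (K : Set (Fin n → ℝ)) (hK : IsCompact K) (hc : Convex ℝ K)
    (i : Fin n) : Nrm ((cond (gam n) K).map fun x => x i) := by
  have hKm := hK.measurableSet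
  have hm : Measurable fun x : Fin n → ℝ => x i := measurable_pi_apply i
  have key : ∀ S T U : Set ℝ, MeasurableSet S → MeasurableSet T → MeasurableSet U → ∀ l : ℝ, 0 < l →
      l < 1 → (∀ x ∈ S, ∀ y ∈ T, (1 - l) * x + l * y ∈ U) →
      ((cond (gam n) K).map fun x => x i).real S ^ (1 - l) *
      ((cond (gam n) K).map fun x => x i).real T ^ l ≤
      ((cond (gam n) K).map fun x => x i).real U := by
    intro S T U hS hT hU l h0 h1 H
    rw [map_measureReal_apply hm hS, map_measureReal_apply hm hT, map_measureReal_apply hm hU,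
      cond_real_apply' _ hKm, cond_real_apply' _ hKm, cond_real_apply' _ hKm]
    set c := ((gam n).real K)⁻¹ with hcdef
    have c0 : 0 ≤ c := by positivity
    have hlc := gam_lc n (K ∩ (fun x => x i) ⁻¹' S) (K ∩ (fun x => x i) ⁻¹' T)
      (K ∩ (fun x => x i) ⁻¹' U) (hKm.inter (hm hS)) (hKm.inter (hm hT)) (hKm.inter (hm hU)) l h0 h1 (by
        rintro x ⟨hx, hxS⟩ y ⟨hy, hyT⟩
        exact ⟨hc hx hy (by linarith) h0.le (by ring), H _ hxS _ hyT⟩)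
    rw [Real.mul_rpow c0 measureReal_nonneg, Real.mul_rpow c0 measureReal_nonneg]
    rcases c0.eq_or_lt with hz | hz
    · rw [← hz, Real.zero_rpow h0.ne']; simp
    have e : c ^ (1 - l) * c ^ l = c := by rw [← Real.rpow_add hz]; simp
    calc _ = (c ^ (1 - l) * c ^ l) * ((gam n).real (K ∩ (fun x => x i) ⁻¹' S) ^ (1 - l) *
          (gam n).real (K ∩ (fun x => x i) ⁻¹' T) ^ l) := by ring
      _ ≤ _ := by rw [e]; exact mul_le_mul_of_nonneg_left hlc hz.le
  refine ⟨fun x => ?_, ?_, ?_⟩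
  · rw [Measure.map_apply hm (measurableSet_singleton x), cond_apply hKm]
    have : gam n (K ∩ (fun x => x i) ⁻¹' {x}) = 0 :=
      measure_mono_null Set.inter_subset_right (gam_coord n i x)
    rw [this, mul_zero]
  · intro s t l h0 h1
    refine key _ _ _ measurableSet_Iic measurableSet_Iic measurableSet_Iic l h0 h1 ?_
    intro x hx y hy
    have hx : x ≤ s := hx
    have hy : y ≤ t := hy
    exact add_le_add (mul_le_mul_of_nonneg_left hx (by linarith)) (mul_le_mul_of_nonneg_left hy h0.le)
  · intro s t l h0 h1
    refine key _ _ _ measurableSet_Ici measurableSet_Ici measurableSet_Ici l h0 h1 ?_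
    intro x hx y hy
    have hx : s ≤ x := hx
    have hy : t ≤ y := hy
    exact add_le_add (mul_le_mul_of_nonneg_left hx (by linarith)) (mul_le_mul_of_nonneg_left hy h0.le)

lemma line_poly {n d : ℕ} (Q : MvPolynomial (Fin n) ℝ) (hQ : Q.totalDegree ≤ d) (p v : Fin n → ℝ) :
    ∃ q : Polynomial ℝ, q.natDegree ≤ d ∧ ∀ t : ℝ, q.eval t = MvPolynomial.eval (p + t • v) Q := by
  refine ⟨MvPolynomial.aeval (fun j => Polynomial.C (v j) * Polynomial.X + Polynomial.C (p j)) Q, ?_, ?_⟩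
  · have := MvPolynomial.aeval_natDegree_le Q hQ
      (fun j => Polynomial.C (v j) * Polynomial.X + Polynomial.C (p j))
      (fun j => Polynomial.natDegree_linear_le)
    simpa using this
  · intro t
    rw [← Polynomial.coe_aeval_eq_eval, ← AlgHom.comp_apply, MvPolynomial.comp_aeval,
      ← MvPolynomial.coe_aeval_eq_eval]
    have : (fun j => (Polynomial.aeval t) (Polynomial.C (v j) * Polynomial.X + Polynomial.C (p j))) =
        p + t • v := by
      ext j
      simp
      ring
    rw [this]
    rfl

lemma loc_bound {n d : ℕ} (hn : 1 ≤ n) (hd : 1 ≤ d) (Q : MvPolynomial (Fin n) ℝ)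
    (hQ : Q.totalDegree ≤ d) (α : ℝ) (hα : 0 < α) (K₀ : Set (Fin n → ℝ)) (hK₀ : IsCompact K₀)
    (hc₀ : Convex ℝ K₀) (hp₀ : 0 < (gam n).real K₀) :
    ((gam n).real ({x | |MvPolynomial.eval x Q| ≤ α} ∩ K₀) / (gam n).real K₀) ^ (2 * d) *
      ((∫ x in K₀, (MvPolynomial.eval x Q) ^ 2 ∂(gam n)) / (gam n).real K₀) ≤
      α ^ 2 * (23040 * d) ^ (2 * d) := by
  have hQc : Continuous fun x => MvPolynomial.eval x Q := MvPolynomial.continuous_eval Q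
  set A : Set (Fin n → ℝ) := {x | |MvPolynomial.eval x Q| ≤ α} with hA
  have hAm : MeasurableSet A := (isClosed_le hQc.abs continuous_const).measurableSet
  set κ := (gam n).real (A ∩ K₀) / (gam n).real K₀ with hκ
  set M2 := (∫ x in K₀, (MvPolynomial.eval x Q) ^ 2 ∂(gam n)) / (gam n).real K₀ with hM2
  have hM0 : 0 ≤ M2 := div_nonneg (integral_nonneg fun _ => sq_nonneg _) hp₀.le
  rcases hM0.eq_or_lt with hz | hM
  · rw [← hz, mul_zero]; positivity
  have hκ0 : 0 ≤ κ := by positivity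
  set e := min α (√M2 / 2) with he
  have hs : 0 < √M2 := Real.sqrt_pos.2 hM
  have he0 : 0 < e := lt_min hα (by positivity)
  have heα : e ≤ α := min_le_left _ _
  have heM : e ^ 2 ≤ M2 / 4 := by
    have : e ≤ √M2 / 2 := min_le_right _ _
    calc e ^ 2 ≤ (√M2 / 2) ^ 2 := pow_le_pow_left₀ he0.le this 2
      _ = _ := by rw [div_pow, Real.sq_sqrt hM0]; norm_num
  have hintg : ∀ K : Set (Fin n → ℝ), IsCompact K → ∀ f : (Fin n → ℝ) → ℝ, Continuous f →
      IntegrableOn f K (gam n) := fun K hK f hf => hf.continuousOn.integrableOn_compact hK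
  have hsub : ∀ K : Set (Fin n → ℝ), IsCompact K →
      ∫ x in K, ((MvPolynomial.eval x Q) ^ 2 - M2) ∂(gam n) =
      (∫ x in K, (MvPolynomial.eval x Q) ^ 2 ∂(gam n)) - (gam n).real K * M2 := by
    intro K hK
    rw [integral_sub (hintg K hK (fun x => (MvPolynomial.eval x Q) ^ 2) (hQc.pow 2)) (hintg K hK _ continuous_const), setIntegral_const,
      smul_eq_mul]
  have hgood : Good n (fun x => (MvPolynomial.eval x Q) ^ 2 - M2) A κ K₀ := by
    refine ⟨hK₀, hc₀, hp₀, ?_, ?_⟩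
    · rw [hsub K₀ hK₀, hM2, mul_div_cancel₀ _ hp₀.ne', sub_self]
    · rw [hκ, div_mul_cancel₀ _ hp₀.ne']
  obtain ⟨K, hK, i, p, v, hpv⟩ := localize hn
    (g := fun x => (MvPolynomial.eval x Q) ^ 2 - M2) ((hQc.pow 2).sub continuous_const) hAm hgood
    (fun x => MvPolynomial.eval x Q) hQc e he0
  obtain ⟨q, hqd, hqe⟩ := line_poly Q hQ p v
  have hKm := hK.cpt.measurableSet
  have hKp := hK.pos
  have hm : Measurable fun x : Fin n → ℝ => x i := measurable_pi_apply i
  have hKne : gam n K ≠ 0 := by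
    intro h; rw [Measure.real, h] at hKp; simp at hKp
  have hP : IsProbabilityMeasure (cond (gam n) K) := cond_isProbabilityMeasure hKne
  have hP' : IsProbabilityMeasure ((cond (gam n) K).map fun x => x i) :=
    Measure.isProbabilityMeasure_map hm.aemeasurable
  have H := oned (nrm_cond n K hK.cpt hK.cvx i) d hd q hqd (2 * α) (by positivity)
  have hqc : Continuous fun x : Fin n → ℝ => q.eval (x i) :=
    q.continuous.comp (continuous_apply i)
  have hcl : |(gam n).real K| = (gam n).real K := abs_of_pos hKp
  rw [integral_map hm.aemeasurable (Continuous.aestronglyMeasurable (by fun_prop)),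
    map_measureReal_apply hm (isClosed_le q.continuous.abs continuous_const).measurableSet,
    cond_real_apply' _ hKm] at H
  have eI : ∫ x, (q.eval (x i)) ^ 2 ∂(cond (gam n) K) =
      ((gam n).real K)⁻¹ * ∫ x in K, (q.eval (x i)) ^ 2 ∂(gam n) := by
    rw [ProbabilityTheory.cond, integral_smul_measure, smul_eq_mul, ENNReal.toReal_inv]; rfl
  rw [eI] at H
  have hcmp : ∀ x ∈ K, |MvPolynomial.eval x Q - q.eval (x i)| < e := by
    intro x hx; rw [hqe]; exact hpv x hx
  have hbig : κ ≤ ((gam n).real K)⁻¹ * (gam n).real (K ∩ (fun x => x i) ⁻¹' {x | |q.eval x| ≤ 2 * α}) := by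
    rw [inv_mul_eq_div, le_div_iff₀ hKp]
    refine hK.big.trans (measureReal_mono ?_)
    rintro x ⟨hxA, hxK⟩
    refine ⟨hxK, ?_⟩
    show |q.eval (x i)| ≤ 2 * α
    have h1 : |MvPolynomial.eval x Q| ≤ α := hxA
    have h2 := hcmp x hxK
    rw [abs_lt] at h2
    rw [abs_le] at h1 ⊢
    constructor <;> linarith [h1.1, h1.2, h2.1, h2.2]
  have hI : M2 / 4 ≤ ((gam n).real K)⁻¹ * ∫ x in K, (q.eval (x i)) ^ 2 ∂(gam n) := by
    rw [inv_mul_eq_div, le_div_iff₀ hKp]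
    have hb := hK.bal
    rw [hsub K hK.cpt] at hb
    have hle : ∫ x in K, (MvPolynomial.eval x Q) ^ 2 ∂(gam n) ≤
        ∫ x in K, (2 * (q.eval (x i)) ^ 2 + M2 / 2) ∂(gam n) := by
      refine setIntegral_mono_on (hintg K hK.cpt _ (hQc.pow 2))
        (hintg K hK.cpt _ (by fun_prop)) hKm ?_
      intro x hx
      have h2 := (hcmp x hx).le
      have h3 : (MvPolynomial.eval x Q - q.eval (x i)) ^ 2 ≤ e ^ 2 := by
        rw [← sq_abs]; exact pow_le_pow_left₀ (abs_nonneg _) h2 2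
      nlinarith [sq_nonneg (MvPolynomial.eval x Q - 2 * q.eval (x i))]
    rw [integral_add (hintg K hK.cpt _ (by fun_prop)) (hintg K hK.cpt _ continuous_const),
      integral_const_mul, setIntegral_const, smul_eq_mul] at hle
    linarith
  have h1 : κ ^ (2 * d) * (M2 / 4) ≤ (2 * α) ^ 2 * (5760 * d) ^ (2 * d) := by
    refine le_trans (mul_le_mul (pow_le_pow_left₀ hκ0 hbig _) hI (by positivity) (by positivity)) H
  have h4 : (16 : ℝ) ≤ 4 ^ (2 * d) := by
    calc (16 : ℝ) = 4 ^ 2 := by norm_num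
      _ ≤ _ := pow_le_pow_right₀ (by norm_num) (by omega)
  calc κ ^ (2 * d) * M2 = 4 * (κ ^ (2 * d) * (M2 / 4)) := by ring
    _ ≤ 4 * ((2 * α) ^ 2 * (5760 * d) ^ (2 * d)) := by linarith
    _ = α ^ 2 * (16 * (5760 * d) ^ (2 * d)) := by ring
    _ ≤ α ^ 2 * (4 ^ (2 * d) * (5760 * d) ^ (2 * d)) := by gcongr
    _ = _ := by rw [← mul_pow]; ring_nf

lemma glob_bound {n d : ℕ} (hn : 1 ≤ n) (hd : 1 ≤ d) (Q : MvPolynomial (Fin n) ℝ)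
    (hQ : Q.totalDegree ≤ d) (α : ℝ) (hα : 0 < α)
    (hi : Integrable (fun x => (MvPolynomial.eval x Q) ^ 2) (gam n)) :
    (gam n).real {x | |MvPolynomial.eval x Q| ≤ α} ^ (2 * d) *
      (∫ x, (MvPolynomial.eval x Q) ^ 2 ∂(gam n)) ≤ α ^ 2 * (23040 * d) ^ (2 * d) := by
  set A : Set (Fin n → ℝ) := {x | |MvPolynomial.eval x Q| ≤ α} with hA
  let B : ℕ → Set (Fin n → ℝ) := fun N => Metric.closedBall 0 N
  have hBm : Monotone B := fun a b hab => Metric.closedBall_subset_closedBall (by exact_mod_cast hab)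
  have hBu : ⋃ N, B N = Set.univ := Metric.iUnion_closedBall_nat 0
  have t1 : Filter.Tendsto (fun N => (gam n).real (B N)) Filter.atTop (nhds 1) := by
    have := (ENNReal.tendsto_toReal (measure_ne_top (gam n) (⋃ N, B N))).comp
      (tendsto_measure_iUnion_atTop (μ := gam n) hBm)
    rw [hBu, measure_univ, ENNReal.toReal_one] at this
    exact this
  have t2 : Filter.Tendsto (fun N => (gam n).real (A ∩ B N)) Filter.atTop (nhds ((gam n).real A)) := by
    have := (ENNReal.tendsto_toReal (measure_ne_top (gam n) (⋃ N, A ∩ B N))).comp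
      (tendsto_measure_iUnion_atTop (μ := gam n)
        (fun a b hab => Set.inter_subset_inter_right A (hBm hab)))
    rw [← Set.inter_iUnion, hBu, Set.inter_univ] at this
    exact this
  have t3 : Filter.Tendsto (fun N => ∫ x in B N, (MvPolynomial.eval x Q) ^ 2 ∂(gam n)) Filter.atTop
      (nhds (∫ x, (MvPolynomial.eval x Q) ^ 2 ∂(gam n))) := by
    have := tendsto_setIntegral_of_monotone (μ := gam n)
      (s := B) (fun N => Metric.isClosed_closedBall.measurableSet) hBm
      (f := fun x => (MvPolynomial.eval x Q) ^ 2) hi.integrableOn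
    rw [hBu,
      setIntegral_univ] at this
    exact this
  have t4 := ((t2.div t1 one_ne_zero).pow (2 * d)).mul (t3.div t1 one_ne_zero)
  rw [div_one, div_one] at t4
  refine le_of_tendsto t4 ?_
  filter_upwards [t1.eventually (lt_mem_nhds zero_lt_one)] with N hN
  exact loc_bound hn hd Q hQ α hα (B N) (isCompact_closedBall _ _) (convex_closedBall _ _) hN

end CW

/-- **Carbery–Wright inequality, Gaussian case.** There is an absolute
constant `c > 0` such that for every `n, d ≥ 1`, every polynomial `Q : ℝⁿ → ℝ` of total
degree at most `d`, and every `α > 0`, with `γ` the standard Gaussian measure on `ℝⁿ`,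
`(∫ Q² dγ)^{1/(2d)} · γ(|Q| ≤ α) ≤ c · d · α^{1/d}`. -/
theorem stmt1 :
    ∃ c : ℝ, 0 < c ∧ ∀ (n d : ℕ), 1 ≤ n → 1 ≤ d →
      ∀ Q : MvPolynomial (Fin n) ℝ, Q.totalDegree ≤ d →
      ∀ α : ℝ, 0 < α →
        (∫ x : Fin n → ℝ, (MvPolynomial.eval x Q) ^ 2
            ∂(Measure.pi fun _ : Fin n => gaussianReal 0 1)) ^ (1 / (2 * (d : ℝ))) *
          ((Measure.pi fun _ : Fin n => gaussianReal 0 1)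
            {x | |MvPolynomial.eval x Q| ≤ α}).toReal
        ≤ c * d * α ^ (1 / (d : ℝ)) := by
  refine ⟨23040, by norm_num, ?_⟩
  intro n d hn hd Q hQ α hα
  have hd' : (1 : ℝ) ≤ d := by exact_mod_cast hd
  by_cases hi : Integrable (fun x => (MvPolynomial.eval x Q) ^ 2)
      (Measure.pi fun _ : Fin n => gaussianReal 0 1)
  · have h := CW.glob_bound hn hd Q hQ α hα hi
    change (CW.gam n).real {x | |MvPolynomial.eval x Q| ≤ α} ^ (2 * d) *
      (∫ x, (MvPolynomial.eval x Q) ^ 2 ∂(CW.gam n)) ≤ _ at h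
    change (∫ x, (MvPolynomial.eval x Q) ^ 2 ∂(CW.gam n)) ^ (1 / (2 * (d : ℝ))) *
      (CW.gam n).real {x | |MvPolynomial.eval x Q| ≤ α} ≤ _
    have hI0 : 0 ≤ ∫ x, (MvPolynomial.eval x Q) ^ 2 ∂(CW.gam n) := integral_nonneg fun _ => sq_nonneg _
    generalize (∫ x, (MvPolynomial.eval x Q) ^ 2 ∂(CW.gam n)) = I at h hI0 ⊢
    have ha0 : 0 ≤ (CW.gam n).real {x | |MvPolynomial.eval x Q| ≤ α} := measureReal_nonneg
    generalize (CW.gam n).real {x | |MvPolynomial.eval x Q| ≤ α} = a at h ha0 ⊢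
    have h2 := Real.rpow_le_rpow (by positivity) h (show 0 ≤ 1 / (2 * (d : ℝ)) by positivity)
    have er : ∀ y : ℝ, 0 ≤ y → (y ^ (2 * d)) ^ (1 / (2 * (d : ℝ))) = y := by
      intro y hy
      rw [← Real.rpow_natCast, ← Real.rpow_mul hy]
      push_cast
      rw [mul_one_div_cancel (by positivity), Real.rpow_one]
    rw [Real.mul_rpow (by positivity) hI0, Real.mul_rpow (by positivity) (by positivity), er _ ha0,
      er _ (by positivity)] at h2
    have e2 : (α ^ 2) ^ (1 / (2 * (d : ℝ))) = α ^ (1 / (d : ℝ)) := by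
      rw [← Real.rpow_natCast, ← Real.rpow_mul hα.le]
      congr 1
      push_cast
      field_simp
    rw [e2] at h2
    linarith
  · rw [integral_undef hi, Real.zero_rpow (by positivity), zero_mul]
    positivity
end

section
/- Let d ≥ 1 and let F_∞ and F_n (n ≥ 1) be random vectors with values in ℝ^d. Assume that F_n converges in distribution to F_∞ as n → ∞, and that for every M ≥ 1, A_M(n) := sup_φ |E[φ(F_n)] − E[φ(F_∞)]| → 0 as n → ∞, where the supremum is taken over all infinitely differentiable functions φ : ℝ^d → ℝ with compact support contained in [−M, M]^d and with sup|φ| ≤ 1. Then d_TV(F_n, F_∞) → 0 as n → ∞, where d_TV(F, G) = sup_{A Borel ⊆ ℝ^d} |P(F ∈ A) − P(G ∈ A)|. -/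
open MeasureTheory Filter

lemma approx_aux {d : ℕ} (μ ν : Measure (Fin d → ℝ)) [IsProbabilityMeasure μ]
    [IsProbabilityMeasure ν] (M δ : ℝ) (hδ : 0 < δ)
    (h : ∀ φ : (Fin d → ℝ) → ℝ, ContDiff ℝ (⊤ : ℕ∞) φ → HasCompactSupport φ →
        tsupport φ ⊆ Set.Icc (fun _ => -M) (fun _ => M) → (∀ y, |φ y| ≤ 1) →
        |(∫ x, φ x ∂μ) - ∫ x, φ x ∂ν| < δ)
    (A : Set (Fin d → ℝ)) (hA : MeasurableSet A) (hAM : A ⊆ Metric.ball 0 M) :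
    |μ.real A - ν.real A| ≤ 3 * δ := by
  have hpos : ENNReal.ofReal (δ / 2) ≠ 0 := by simpa using hδ
  obtain ⟨K, hKA, hK, hKd⟩ := hA.exists_isClosed_sdiff_lt (μ := μ + ν) (measure_ne_top _ _) hpos
  obtain ⟨U, hAU, hU, -, hUd⟩ := hA.exists_isOpen_sdiff_lt (μ := μ + ν) (measure_ne_top _ _) hpos
  obtain ⟨φ, hφ, hr, hs, h1⟩ := exists_contMDiff_support_eq_eq_one_iff
    (modelWithCornersSelf ℝ (Fin d → ℝ)) (n := (⊤ : ℕ∞))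
    (s := U ∩ Metric.ball 0 M) (t := K) (hU.inter Metric.isOpen_ball) hK
    (fun x hx => ⟨hAU (hKA hx), hAM (hKA hx)⟩)
  have hr' : ∀ x, 0 ≤ φ x ∧ φ x ≤ 1 := fun x => hr ⟨x, rfl⟩
  have hsub : tsupport φ ⊆ Set.Icc (fun _ => -M) (fun _ => M) := by
    refine closure_minimal ?_ isClosed_Icc
    rw [hs]
    rintro x ⟨-, hx⟩
    rw [mem_ball_zero_iff] at hx
    have hx' : ∀ i, |x i| ≤ M := fun i => (norm_le_pi_norm x i).trans hx.le
    exact ⟨fun i => (abs_le.1 (hx' i)).1, fun i => (abs_le.1 (hx' i)).2⟩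
  have hlt := h φ hφ.contDiff (isCompact_Icc.of_isClosed_subset (isClosed_tsupport _) hsub) hsub
    (fun y => abs_le.2 ⟨by linarith [(hr' y).1], (hr' y).2⟩)
  have hcont : Continuous φ := hφ.contDiff.continuous
  have key : ∀ ρ : Measure (Fin d → ℝ), IsProbabilityMeasure ρ → ρ ≤ μ + ν →
      |∫ x, φ x ∂ρ - ρ.real A| ≤ δ := by
    intro ρ _ hρ
    have hi : Integrable φ ρ := Integrable.of_bound hcont.aestronglyMeasurable 1
      (ae_of_all _ fun x => by
        rw [Real.norm_eq_abs]; exact abs_le.2 ⟨by linarith [(hr' x).1], (hr' x).2⟩)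
    have hm1 : ρ.real (A \ K) ≤ δ / 2 :=
      ENNReal.toReal_le_of_le_ofReal (by linarith) ((hρ _).trans hKd.le)
    have hm2 : ρ.real (U \ A) ≤ δ / 2 :=
      ENNReal.toReal_le_of_le_ofReal (by linarith) ((hρ _).trans hUd.le)
    have e1 : ρ.real K ≤ ∫ x, φ x ∂ρ := by
      rw [← integral_indicator_one hK.measurableSet]
      refine integral_mono ((integrable_const (1:ℝ)).indicator hK.measurableSet) hi fun x => ?_
      by_cases hx : x ∈ K
      · simp [hx, (h1 x).1 hx]
      · simp [hx, (hr' x).1]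
    have e2 : ∫ x, φ x ∂ρ ≤ ρ.real U := by
      rw [← integral_indicator_one hU.measurableSet]
      refine integral_mono hi ((integrable_const (1:ℝ)).indicator hU.measurableSet) fun x => ?_
      by_cases hx : x ∈ U
      · simp [hx, (hr' x).2]
      · have : x ∉ Function.support φ := by rw [hs]; exact fun h => hx h.1
        simp [hx, Function.notMem_support.1 this]
    have e3 := measureReal_sdiff (μ := ρ) hKA hK.measurableSet
    have e4 := measureReal_sdiff (μ := ρ) hAU hA
    rw [abs_le]; constructor <;> linarith
  have k1 := abs_le.1 (key μ inferInstance (Measure.le_add_right le_rfl))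
  have k2 := abs_le.1 (key ν inferInstance (Measure.le_add_left le_rfl))
  have k3 := abs_lt.1 hlt
  rw [abs_le]; constructor <;> linarith [k1.1, k1.2, k2.1, k2.2, k3.1, k3.2]

/-- If `F_n → F_∞` in distribution and, for every `M ≥ 1`,
`sup_φ |E[φ(F_n)] - E[φ(F_∞)]| → 0` where the sup runs over smooth `φ` supported in
`[-M,M]^d` and bounded by `1`, then `F_n → F_∞` in total variation:
`sup_{A Borel} |P(F_n ∈ A) - P(F_∞ ∈ A)| → 0`. -/
theorem stmt13 {Ω : Type*} [MeasurableSpace Ω] (P : Measure Ω) [IsProbabilityMeasure P]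
    (d : ℕ) (hd : 1 ≤ d)
    (F : ℕ → Ω → (Fin d → ℝ)) (Finf : Ω → (Fin d → ℝ))
    (hFm : ∀ n, Measurable (F n)) (hFim : Measurable Finf)
    (hconv : ∀ φ : (Fin d → ℝ) → ℝ, Continuous φ → (∃ C, ∀ x, |φ x| ≤ C) →
      Tendsto (fun n => ∫ ω, φ (F n ω) ∂P) atTop (nhds (∫ ω, φ (Finf ω) ∂P)))
    (hA : ∀ M : ℝ, 1 ≤ M → ∀ ε > (0 : ℝ), ∃ N : ℕ, ∀ n ≥ N,
      ∀ φ : (Fin d → ℝ) → ℝ, ContDiff ℝ (⊤ : ℕ∞) φ → HasCompactSupport φ →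
        tsupport φ ⊆ Set.Icc (fun _ => -M) (fun _ => M) → (∀ y, |φ y| ≤ 1) →
        |(∫ ω, φ (F n ω) ∂P) - ∫ ω, φ (Finf ω) ∂P| < ε) :
    ∀ ε > (0 : ℝ), ∃ N : ℕ, ∀ n ≥ N, ∀ A : Set (Fin d → ℝ), MeasurableSet A →
      |(P (F n ⁻¹' A)).toReal - (P (Finf ⁻¹' A)).toReal| ≤ ε := by
  intro ε hε
  have : IsProbabilityMeasure (P.map Finf) := Measure.isProbabilityMeasure_map hFim.aemeasurable
  have hFp : ∀ n, IsProbabilityMeasure (P.map (F n)) :=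
    fun n => Measure.isProbabilityMeasure_map (hFm n).aemeasurable
  set ν := P.map Finf with hν
  obtain ⟨M, hM1, hM⟩ : ∃ M : ℝ, 1 ≤ M ∧ 1 - ε / 10 < ν.real (Metric.ball 0 M) := by
    have ht : Tendsto (fun k : ℕ => ν (Metric.ball 0 (k : ℝ))) atTop (nhds 1) := by
      have := tendsto_measure_iUnion_atTop (μ := ν)
        (s := fun k : ℕ => Metric.ball (0 : Fin d → ℝ) (k : ℝ))
        (fun a b hab => Metric.ball_subset_ball (by exact_mod_cast hab))
      rwa [Metric.iUnion_ball_nat, measure_univ] at this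
    have ht' := (ENNReal.tendsto_toReal ENNReal.one_ne_top).comp ht
    have hlt : 1 - ε / 10 < (1 : ENNReal).toReal := by simp; linarith
    obtain ⟨k, hk, hk1⟩ := ((ht'.eventually_const_lt hlt).and (eventually_ge_atTop 1)).exists
    exact ⟨k, by exact_mod_cast hk1, hk⟩
  obtain ⟨N, hN⟩ := hA M hM1 (ε / 10) (by linarith)
  refine ⟨N, fun n hn A hAm => ?_⟩
  have := hFp n
  set μ := P.map (F n) with hμ
  have key := approx_aux μ ν M (ε / 10) (by linarith) (fun φ h1 h2 h3 h4 => by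
    rw [hμ, hν, integral_map (hFm n).aemeasurable h1.continuous.aestronglyMeasurable,
      integral_map hFim.aemeasurable h1.continuous.aestronglyMeasurable]
    exact hN n hn φ h1 h2 h3 h4)
  rw [← Measure.map_apply (hFm n) hAm, ← Measure.map_apply hFim hAm]
  change |μ.real A - ν.real A| ≤ ε
  have hB : MeasurableSet (Metric.ball (0 : Fin d → ℝ) M) := measurableSet_ball
  have k1 := abs_le.1 (key _ (hAm.inter hB) Set.inter_subset_right)
  have k2 := abs_le.1 (key _ hB subset_rfl)
  have s1 := measureReal_inter_add_sdiff (μ := μ) (s := A) hB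
  have s2 := measureReal_inter_add_sdiff (μ := ν) (s := A) hB
  have c1 : μ.real (A \ Metric.ball 0 M) ≤ 1 - μ.real (Metric.ball 0 M) := by
    rw [← probReal_compl_eq_one_sub hB]; exact measureReal_mono fun x hx => hx.2
  have c2 : ν.real (A \ Metric.ball 0 M) ≤ 1 - ν.real (Metric.ball 0 M) := by
    rw [← probReal_compl_eq_one_sub hB]; exact measureReal_mono fun x hx => hx.2
  have p1 : 0 ≤ μ.real (A \ Metric.ball 0 M) := measureReal_nonneg
  have p2 : 0 ≤ ν.real (A \ Metric.ball 0 M) := measureReal_nonneg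
  rw [abs_le]; constructor <;> linarith [k1.1, k1.2, k2.1, k2.2]
end
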